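/- For all b ≥ 2 and every ε with 0 < ε < 0.1, there is a constant C = C(b,ε) such that whenever x^{3/13+3ε} ≤ D ≤ x^{8/31−ε} one has S_b(x,D) ≤ C x^{1/2−ε}. -/

import Mathlib

/-- A positive integer `n` is a base-`b` palindrome if `b ∤ n` and its base-`b`
digit string reads the same forwards and backwards. -/
def IsBPalindrome (b n : ℕ) : Prop := ¬ b ∣ n ∧ (Nat.digits b n).Palindrome

/-- `𝒫*_b(x)`: base-`b` palindromes `n ≤ x` with `gcd(n, b³ - b) = 1`. -/
def PstarSet (b : ℕ) (x : ℝ) : Set ℕ :=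
  {n : ℕ | 0 < n ∧ (n : ℝ) ≤ x ∧ IsBPalindrome b n ∧ Nat.gcd n (b ^ 3 - b) = 1}

/-- `S_b(x, D)`: the number of `n ∈ 𝒫*_b(x)` divisible by `d²` for some
integer `d` with `D ≤ d ≤ 2D`. -/
noncomputable def Scount (b : ℕ) (x D : ℝ) : ℕ :=
  {n : ℕ | n ∈ PstarSet b x ∧ ∃ d : ℕ, D ≤ (d : ℝ) ∧ (d : ℝ) ≤ 2 * D ∧ d ^ 2 ∣ n}.ncard

/-- The additive character `t ↦ exp (2πit)`. -/
noncomputable def unitExp (t : ℝ) : ℂ := Complex.exp ((2 * Real.pi * t : ℝ) * Complex.I)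

lemma unitExp_add (s t : ℝ) : unitExp (s + t) = unitExp s * unitExp t := by
  unfold unitExp
  rw [← Complex.exp_add]
  congr 1
  push_cast
  ring

lemma norm_unitExp (t : ℝ) : ‖unitExp t‖ = 1 := Complex.norm_exp_ofReal_mul_I _

lemma unitExp_int (n : ℤ) : unitExp n = 1 := by
  unfold unitExp
  rw [← Complex.exp_int_mul_two_pi_mul_I n]
  congr 1
  push_cast
  ring

lemma unitExp_mul_conj (s t : ℝ) : unitExp s * (starRingEnd ℂ) (unitExp t) = unitExp (s - t) := by
  unfold unitExp
  rw [← Complex.exp_conj, ← Complex.exp_add]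
  congr 1
  simp only [map_mul, Complex.conj_ofReal, Complex.conj_I]
  push_cast
  ring

lemma unitExp_add_int (t : ℝ) (n : ℤ) : unitExp (t + n) = unitExp t := by
  rw [unitExp_add, unitExp_int, mul_one]

lemma unitExp_nat_mul_add_int (h : ℕ) (t : ℝ) (n : ℤ) :
    unitExp (h * (t + n)) = unitExp (h * t) := by
  rw [mul_add, show (h : ℝ) * (n : ℝ) = ((h * n : ℤ) : ℝ) by push_cast; ring, unitExp_add_int]

lemma inv_unitExp_sub_one {θ : ℝ} (h0 : 0 < θ) (h1 : θ ≤ 1 / 2) :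
    (unitExp θ - 1)⁻¹ =
      -(1 / 2 : ℂ) - (1 / 2 * (Real.cos (Real.pi * θ) / Real.sin (Real.pi * θ)) : ℝ) * Complex.I := by
  have hs : 0 < Real.sin (Real.pi * θ) := by
    apply Real.sin_pos_of_pos_of_lt_pi
    · positivity
    · nlinarith [Real.pi_pos]
  set s := Real.sin (Real.pi * θ) with hsdef
  set c := Real.cos (Real.pi * θ) with hcdef
  have hsc : s ^ 2 + c ^ 2 = 1 := Real.sin_sq_add_cos_sq _
  have he : unitExp θ - 1 = ((-2 * s ^ 2 : ℝ) : ℂ) + ((2 * s * c : ℝ) : ℂ) * Complex.I := by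
    unfold unitExp
    rw [Complex.exp_mul_I, ← Complex.ofReal_cos, ← Complex.ofReal_sin,
      show 2 * Real.pi * θ = 2 * (Real.pi * θ) by ring, Real.cos_two_mul, Real.sin_two_mul,
      ← hsdef, ← hcdef, show 2 * c ^ 2 - 1 = 1 - 2 * s ^ 2 by linarith]
    push_cast
    ring
  have hs' : (s : ℂ) ≠ 0 := by exact_mod_cast hs.ne'
  have hsc' : (s : ℂ) ^ 2 + (c : ℂ) ^ 2 = 1 := by exact_mod_cast hsc
  apply inv_eq_of_mul_eq_one_right
  rw [he]
  push_cast
  field_simp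
  ring_nf
  rw [Complex.I_sq]
  linear_combination hsc'

/-- The Kusmin–Landau inequality for slowly varying decreasing increments. -/
lemma kusmin_landau (g : ℕ → ℝ) (M : ℕ) (δ : ℝ) (hδ : 0 < δ)
    (hlo : ∀ n < M, δ ≤ g (n + 1) - g n) (hhi : ∀ n < M, g (n + 1) - g n ≤ 1 / 2)
    (hanti : ∀ n, n + 1 < M → g (n + 2) - g (n + 1) ≤ g (n + 1) - g n) :
    ‖∑ n ∈ Finset.range M, unitExp (g n)‖ ≤ 3 / δ := by
  rcases Nat.eq_zero_or_pos M with rfl | hM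
  · simp; positivity
  obtain ⟨m, rfl⟩ : ∃ m, M = m + 1 := ⟨M - 1, by omega⟩
  set θ : ℕ → ℝ := fun n => g (n + 1) - g n with hθ
  set κ : ℕ → ℝ := fun n => 1 / 2 * (Real.cos (Real.pi * θ n) / Real.sin (Real.pi * θ n)) with hκ
  set w : ℕ → ℂ := fun n => -(1 / 2 : ℂ) - (κ n : ℂ) * Complex.I with hw
  have hpi := Real.pi_gt_three
  have hsin : ∀ n < m + 1, 2 * θ n ≤ Real.sin (Real.pi * θ n) := fun n hn => by
    have h1 := hlo n hn
    have h2 := hhi n hn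
    have := Real.mul_le_sin (x := Real.pi * θ n) (by simp only [hθ]; nlinarith)
      (by simp only [hθ]; nlinarith)
    calc 2 * θ n = 2 / Real.pi * (Real.pi * θ n) := by field_simp
      _ ≤ _ := this
  have hθpos : ∀ n < m + 1, 0 < θ n := fun n hn => hδ.trans_le (hlo n hn)
  have hcos : ∀ n < m + 1, 0 ≤ Real.cos (Real.pi * θ n) := fun n hn => by
    have h1 := hθpos n hn
    have h2 : θ n ≤ 1 / 2 := hhi n hn
    apply Real.cos_nonneg_of_mem_Icc
    constructor <;> nlinarith
  have hκ0 : ∀ n < m + 1, 0 ≤ κ n := fun n hn =>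
    mul_nonneg (by norm_num) (div_nonneg (hcos n hn) (by linarith [hsin n hn, hθpos n hn]))
  have hκ1 : ∀ n < m + 1, κ n ≤ 1 / (4 * δ) := fun n hn => by
    have h1 : Real.cos (Real.pi * θ n) / Real.sin (Real.pi * θ n) ≤ 1 / (2 * δ) := by
      apply div_le_div₀ (by norm_num) (Real.cos_le_one _) (by positivity)
      have : δ ≤ θ n := hlo n hn
      linarith [hsin n hn]
    calc κ n ≤ 1 / 2 * (1 / (2 * δ)) := by simp only [hκ]; gcongr
      _ = _ := by field_simp; norm_num
  have hκmono : ∀ n, n < m → κ n ≤ κ (n + 1) := fun n hn => by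
    have h1 := hθpos (n + 1) (by omega)
    have h2 : θ n ≤ 1 / 2 := hhi n (by omega)
    have h3 : θ (n + 1) ≤ θ n := hanti n (by omega)
    simp only [hκ]
    refine mul_le_mul_of_nonneg_left ?_ (by norm_num)
    apply div_le_div₀ (hcos (n + 1) (by omega))
    · apply Real.cos_le_cos_of_nonneg_of_le_pi <;> nlinarith
    · linarith [hsin (n + 1) (by omega)]
    · apply Real.sin_le_sin_of_le_of_le_pi_div_two <;> nlinarith
  have hz : ∀ n < m + 1, unitExp (g n) = w n * (unitExp (g (n + 1)) - unitExp (g n)) := by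
    intro n hn
    have h1 := hθpos n hn
    have h2 : θ n ≤ 1 / 2 := hhi n hn
    have h3 := inv_unitExp_sub_one h1 h2
    have h4 : unitExp (g (n + 1)) = unitExp (θ n) * unitExp (g n) := by
      rw [← unitExp_add]; simp [hθ]
    have h5 : unitExp (θ n) - 1 ≠ 0 := by
      intro h
      rw [h, inv_zero] at h3
      have := congrArg Complex.re h3
      rw [Complex.sub_re, Complex.re_ofReal_mul, Complex.I_re] at this
      norm_num at this
    rw [h4, show w n = (unitExp (θ n) - 1)⁻¹ from h3.symm]
    field_simp
  have hparts : ∀ j ≤ m, ∑ n ∈ Finset.range (j + 1), unitExp (g n) =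
      w j * unitExp (g (j + 1)) - w 0 * unitExp (g 0) -
        ∑ n ∈ Finset.range j, (w (n + 1) - w n) * unitExp (g (n + 1)) := by
    intro j
    induction j with
    | zero => intro _; simpa [mul_sub] using hz 0 (by omega)
    | succ j ih =>
      intro hj
      rw [Finset.sum_range_succ, ih (by omega), Finset.sum_range_succ _ j]
      linear_combination hz (j + 1) (by omega)
  have hwn : ∀ n < m + 1, ‖w n‖ ≤ 1 / 2 + 1 / (4 * δ) := fun n hn => by
    refine (norm_sub_le _ _).trans ?_
    rw [norm_mul, Complex.norm_I, Complex.norm_real, Real.norm_of_nonneg (hκ0 n hn)]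
    have := hκ1 n hn
    norm_num
    norm_num at this
    linarith
  have hwd : ∀ n < m, ‖w (n + 1) - w n‖ = κ (n + 1) - κ n := fun n hn => by
    have : w (n + 1) - w n = ((-(κ (n + 1) - κ n) : ℝ) : ℂ) * Complex.I := by
      simp only [hw]; push_cast; ring
    rw [this, norm_mul, Complex.norm_I, Complex.norm_real, norm_neg,
      Real.norm_of_nonneg (by linarith [hκmono n hn]), mul_one]
  have hδ2 : δ ≤ 1 / 2 := (hlo 0 hM).trans (hhi 0 hM)
  have h1δ : 1 / 2 ≤ 1 / (4 * δ) := by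
    apply one_div_le_one_div_of_le <;> linarith
  rw [hparts m le_rfl]
  calc _ ≤ ‖w m * unitExp (g (m + 1))‖ + ‖w 0 * unitExp (g 0)‖ +
        ‖∑ n ∈ Finset.range m, (w (n + 1) - w n) * unitExp (g (n + 1))‖ :=
        (norm_sub_le _ _).trans (add_le_add_left (norm_sub_le _ _) _)
    _ ≤ (1 / 2 + 1 / (4 * δ)) + (1 / 2 + 1 / (4 * δ)) + 1 / (4 * δ) := by
        gcongr
        · rw [norm_mul, norm_unitExp, mul_one]; exact hwn m (by omega)
        · rw [norm_mul, norm_unitExp, mul_one]; exact hwn 0 (by omega)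
        · calc _ ≤ ∑ n ∈ Finset.range m, ‖(w (n + 1) - w n) * unitExp (g (n + 1))‖ :=
                norm_sum_le _ _
            _ = ∑ n ∈ Finset.range m, (κ (n + 1) - κ n) := by
                refine Finset.sum_congr rfl fun n hn => ?_
                rw [norm_mul, norm_unitExp, mul_one, hwd n (Finset.mem_range.1 hn)]
            _ = κ m - κ 0 := Finset.sum_range_sub _ _
            _ ≤ _ := by linarith [hκ0 0 hM, hκ1 m (by omega)]
    _ ≤ 5 * (1 / (4 * δ)) := by linarith
    _ ≤ 3 / δ := by
        rw [show 5 * (1 / (4 * δ)) = (5 / 4) / δ by field_simp]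
        gcongr
        norm_num

/-- Iterated forward difference of `y ↦ y⁻ⁿ` with the given list of steps. -/
noncomputable def invPowDiff (n : ℕ) : List ℝ → ℝ → ℝ
  | [], y => 1 / y ^ n
  | h :: hs, y => invPowDiff n hs (y + h) - invPowDiff n hs y

lemma hasDerivAt_invPowDiff (n : ℕ) (hs : List ℝ) (hpos : ∀ h ∈ hs, 0 < h) (y : ℝ) (hy : 0 < y) :
    HasDerivAt (invPowDiff n hs) (-n * invPowDiff (n + 1) hs y) y := by
  induction hs generalizing y with
  | nil =>
    have h := (hasDerivAt_pow n y).fun_inv (pow_ne_zero n hy.ne')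
    have heq : invPowDiff n [] = fun z : ℝ => (z ^ n)⁻¹ := by
      funext z; simp [invPowDiff]
    rw [heq]
    refine h.congr_deriv ?_
    rcases n with _ | n
    · simp
    · simp only [invPowDiff, Nat.add_sub_cancel]
      field_simp
      ring
  | cons a hs ih =>
    have ha := hpos a (by simp)
    have hpos' : ∀ h ∈ hs, 0 < h := fun h hh => hpos h (by simp [hh])
    have h1 := (ih hpos' (y + a) (by linarith)).comp_add_const y a
    refine (h1.fun_sub (ih hpos' y hy)).congr_deriv ?_
    simp only [invPowDiff]
    ring

lemma exists_invPowDiff_eq (n : ℕ) (hs : List ℝ) (hpos : ∀ h ∈ hs, 0 < h) (y : ℝ) (hy : 0 < y) :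
    ∃ η, y ≤ η ∧ η ≤ y + hs.sum ∧ invPowDiff n hs y =
      (-1) ^ hs.length * (n.ascFactorial hs.length : ℝ) * hs.prod / η ^ (n + hs.length) := by
  induction hs generalizing n y with
  | nil => exact ⟨y, le_rfl, by simp, by simp [invPowDiff]⟩
  | cons a hs ih =>
    have ha := hpos a (by simp)
    have hpos' : ∀ h ∈ hs, 0 < h := fun h hh => hpos h (by simp [hh])
    obtain ⟨ξ, ⟨hξ1, hξ2⟩, hξ⟩ := exists_hasDerivAt_eq_slope (invPowDiff n hs)
      (fun z => -n * invPowDiff (n + 1) hs z) (show y < y + a by linarith)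
      (fun z hz => (hasDerivAt_invPowDiff n hs hpos' z
        (hy.trans_le hz.1)).continuousAt.continuousWithinAt)
      (fun z hz => hasDerivAt_invPowDiff n hs hpos' z (hy.trans hz.1))
    obtain ⟨η, h1, h2, h3⟩ := ih (n + 1) hpos' ξ (hy.trans hξ1)
    refine ⟨η, by linarith, by simp; linarith, ?_⟩
    rw [h3, add_sub_cancel_left, eq_div_iff ha.ne'] at hξ
    have h4 : (n : ℝ) * ((n + 1).ascFactorial hs.length : ℝ) =
        (n.ascFactorial (hs.length + 1) : ℝ) := by
      exact_mod_cast Nat.succ_ascFactorial n hs.length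
    simp only [invPowDiff, ← hξ, List.length_cons, List.prod_cons, ← h4]
    rw [show n + (hs.length + 1) = n + 1 + hs.length by ring]
    ring

lemma sum_sum_dist_le (w : ℕ → ℝ) (hw : ∀ r, 0 ≤ w r) (L : ℕ) :
    ∑ i ∈ Finset.range L, ∑ j ∈ Finset.range L, w (i - j + (j - i)) ≤
      L * (w 0 + 2 * ∑ r ∈ Finset.Ico 1 L, w r) := by
  have hW : ∀ m, m + 1 ≤ L → ∑ r ∈ Finset.range m, w (r + 1) ≤ ∑ r ∈ Finset.Ico 1 L, w r := by
    intro m hm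
    rw [Finset.sum_Ico_eq_sum_range]
    simp_rw [add_comm 1]
    exact Finset.sum_le_sum_of_subset_of_nonneg (Finset.range_subset_range.2 (by omega))
      fun _ _ _ => hw _
  have key : ∀ i ∈ Finset.range L, ∑ j ∈ Finset.range L, w (i - j + (j - i)) ≤
      w 0 + 2 * ∑ r ∈ Finset.Ico 1 L, w r := by
    intro i hi
    rw [Finset.mem_range] at hi
    rw [← Finset.sum_range_add_sum_Ico _ hi, Finset.sum_range_succ,
      Finset.sum_Ico_eq_sum_range]
    have h1 : ∑ j ∈ Finset.range i, w (i - j + (j - i)) = ∑ j ∈ Finset.range i, w (j + 1) := by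
      rw [← Finset.sum_range_reflect]
      refine Finset.sum_congr rfl fun j hj => ?_
      rw [Finset.mem_range] at hj
      congr 1
      omega
    have h2 : ∑ j ∈ Finset.range (L - (i + 1)), w (i - (i + 1 + j) + (i + 1 + j - i)) =
        ∑ j ∈ Finset.range (L - (i + 1)), w (j + 1) := by
      refine Finset.sum_congr rfl fun j _ => ?_
      congr 1
      omega
    rw [h1, h2]
    have := hW i (by omega)
    have := hW (L - (i + 1)) (by omega)
    simp
    linarith
  calc _ ≤ ∑ i ∈ Finset.range L, (w 0 + 2 * ∑ r ∈ Finset.Ico 1 L, w r) := Finset.sum_le_sum key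
    _ = _ := by rw [Finset.sum_const, Finset.card_range, nsmul_eq_mul]

lemma sum_norm_sq_sum_le {ι : Type*} (s : Finset ι) (L : ℕ) (z : ι → ℕ → ℂ) (w : ℕ → ℝ)
    (h : ∀ j r, j + r < L → ‖∑ m ∈ s, z m (j + r) * (starRingEnd ℂ) (z m j)‖ ≤ w r)
    (hw : ∀ r, 0 ≤ w r) :
    ∑ m ∈ s, ‖∑ l ∈ Finset.range L, z m l‖ ^ 2 ≤
      L * (w 0 + 2 * ∑ r ∈ Finset.Ico 1 L, w r) := by
  have h' : ∀ i ∈ Finset.range L, ∀ j ∈ Finset.range L,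
      ‖∑ m ∈ s, z m i * (starRingEnd ℂ) (z m j)‖ ≤ w (i - j + (j - i)) := by
    intro i hi j hj
    rw [Finset.mem_range] at hi hj
    rcases le_total j i with hij | hij
    · obtain ⟨r, rfl⟩ := Nat.exists_eq_add_of_le hij
      convert h j r hi using 2
      omega
    · obtain ⟨r, rfl⟩ := Nat.exists_eq_add_of_le hij
      rw [← RCLike.norm_conj, map_sum]
      convert h i r hj using 1
      · refine congrArg _ (Finset.sum_congr rfl fun m _ => ?_)
        rw [map_mul, RCLike.conj_conj, mul_comm]
      · congr 1; omega
  have hexp : ((∑ m ∈ s, ‖∑ l ∈ Finset.range L, z m l‖ ^ 2 : ℝ) : ℂ) =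
      ∑ i ∈ Finset.range L, ∑ j ∈ Finset.range L, ∑ m ∈ s, z m i * (starRingEnd ℂ) (z m j) := by
    rw [Complex.ofReal_sum]
    have : ∀ m ∈ s, ((‖∑ l ∈ Finset.range L, z m l‖ ^ 2 : ℝ) : ℂ) =
        ∑ i ∈ Finset.range L, ∑ j ∈ Finset.range L, z m i * (starRingEnd ℂ) (z m j) := by
      intro m _
      rw [Complex.ofReal_pow, ← Complex.mul_conj', map_sum, Finset.sum_mul_sum]
    rw [Finset.sum_congr rfl this, Finset.sum_comm]
    refine Finset.sum_congr rfl fun i _ => Finset.sum_comm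
  calc _ = ‖((∑ m ∈ s, ‖∑ l ∈ Finset.range L, z m l‖ ^ 2 : ℝ) : ℂ)‖ := by
        rw [Complex.norm_real, Real.norm_of_nonneg (Finset.sum_nonneg fun _ _ => sq_nonneg _)]
    _ ≤ ∑ i ∈ Finset.range L, ∑ j ∈ Finset.range L, w (i - j + (j - i)) := by
        rw [hexp]
        refine (norm_sum_le _ _).trans (Finset.sum_le_sum fun i hi => ?_)
        exact (norm_sum_le _ _).trans (Finset.sum_le_sum fun j hj => h' i hi j hj)
    _ ≤ _ := sum_sum_dist_le w hw L

/-- The Weyl–van der Corput inequality with shifts by multiples of `P`. -/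
lemma weyl_vanDerCorput (z : ℕ → ℂ) (hz : ∀ n, ‖z n‖ ≤ 1) (M P L D : ℕ) (hL : 0 < L)
    (hM : M ≤ D) (hPL : P * L ≤ D) :
    ‖∑ n ∈ Finset.range M, z n‖ ^ 2 ≤ 2 * D / L * (D + 2 * ∑ l ∈ Finset.Ico 1 L,
      ‖∑ n ∈ Finset.range (M - P * l), z (n + P * l) * (starRingEnd ℂ) (z n)‖) := by
  set a : ℕ → ℕ → ℂ := fun m l => if P * l ≤ m ∧ m < M + P * l then z (m - P * l) else 0 with ha
  set w : ℕ → ℝ := fun l =>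
    ‖∑ n ∈ Finset.range (M - P * l), z (n + P * l) * (starRingEnd ℂ) (z n)‖ with hw
  have h1 : ∀ l ∈ Finset.range L, ∑ m ∈ Finset.range (M + P * L), a m l =
      ∑ n ∈ Finset.range M, z n := by
    intro l hl
    have hl' : P * l ≤ P * L := Nat.mul_le_mul_left _ (Finset.mem_range.1 hl).le
    have hsub : Finset.Ico (P * l) (M + P * l) ⊆ Finset.range (M + P * L) := by
      intro m hm
      rw [Finset.mem_Ico] at hm
      rw [Finset.mem_range]
      omega
    rw [← Finset.sum_subset hsub]
    · rw [Finset.sum_Ico_eq_sum_range, Nat.add_sub_cancel]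
      refine Finset.sum_congr rfl fun n hn => ?_
      rw [Finset.mem_range] at hn
      simp only [ha]
      rw [if_pos (by omega), Nat.add_sub_cancel_left]
    · intro m _ hm
      rw [Finset.mem_Ico] at hm
      simp only [ha]
      rw [if_neg hm]
  have h2 : ∀ j r, j + r < L → ‖∑ m ∈ Finset.range (M + P * L),
      a m (j + r) * (starRingEnd ℂ) (a m j)‖ ≤ w r := by
    intro j r hjr
    have hl' : P * (j + r) ≤ P * L := Nat.mul_le_mul_left _ hjr.le
    rw [mul_add] at hl'
    have hsub : Finset.Ico (P * j + P * r) (M + P * j) ⊆ Finset.range (M + P * L) := by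
      intro m hm
      rw [Finset.mem_Ico] at hm
      rw [Finset.mem_range]
      omega
    rw [← Finset.sum_subset hsub]
    · rw [Finset.sum_Ico_eq_sum_range, show M + P * j - (P * j + P * r) = M - P * r by omega]
      rw [← RCLike.norm_conj, map_sum]
      apply le_of_eq
      simp only [hw]
      congr 1
      refine Finset.sum_congr rfl fun n hn => ?_
      rw [Finset.mem_range] at hn
      simp only [ha, mul_add]
      rw [if_pos (by omega), if_pos (by omega), map_mul, RCLike.conj_conj, mul_comm,
        Nat.add_sub_cancel_left, show P * j + P * r + n - P * j = n + P * r by omega]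
    · intro m _ hm
      rw [Finset.mem_Ico] at hm
      simp only [ha, mul_add]
      by_cases hc : P * j + P * r ≤ m ∧ m < M + (P * j + P * r)
      · rw [if_neg (show ¬(P * j ≤ m ∧ m < M + P * j) by omega), map_zero, mul_zero]
      · rw [if_neg hc, zero_mul]
  have h3 := sum_norm_sq_sum_le _ L a w h2 fun _ => norm_nonneg _
  have h4 : w 0 ≤ D := by
    simp only [hw]
    calc _ ≤ ∑ n ∈ Finset.range (M - P * 0), ‖z (n + P * 0) * (starRingEnd ℂ) (z n)‖ :=
          norm_sum_le _ _
      _ ≤ ∑ n ∈ Finset.range (M - P * 0), (1 : ℝ) := by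
          refine Finset.sum_le_sum fun n _ => ?_
          rw [norm_mul, RCLike.norm_conj]
          exact mul_le_one₀ (hz _) (norm_nonneg _) (hz _)
      _ ≤ D := by simpa using hM
  have h5 : (L : ℝ) * ‖∑ n ∈ Finset.range M, z n‖ ≤
      ∑ m ∈ Finset.range (M + P * L), ‖∑ l ∈ Finset.range L, a m l‖ := by
    calc (L : ℝ) * ‖∑ n ∈ Finset.range M, z n‖ =
          ‖∑ l ∈ Finset.range L, ∑ m ∈ Finset.range (M + P * L), a m l‖ := by
            rw [Finset.sum_congr rfl h1]; simp
      _ ≤ _ := by rw [Finset.sum_comm]; exact norm_sum_le _ _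
  have h6 := sq_sum_le_card_mul_sum_sq (s := Finset.range (M + P * L))
    (f := fun m => ‖∑ l ∈ Finset.range L, a m l‖)
  have hL' : (0 : ℝ) < L := by exact_mod_cast hL
  have hMP : ((M + P * L : ℕ) : ℝ) ≤ 2 * D := by exact_mod_cast (by omega : M + P * L ≤ 2 * D)
  rw [Finset.card_range] at h6
  have hE : 0 ≤ ∑ r ∈ Finset.Ico 1 L, w r := Finset.sum_nonneg fun _ _ => norm_nonneg _
  have h7 : (L * ‖∑ n ∈ Finset.range M, z n‖) ^ 2 ≤
      2 * D * (L * (D + 2 * ∑ r ∈ Finset.Ico 1 L, w r)) := by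
    calc _ ≤ (∑ m ∈ Finset.range (M + P * L), ‖∑ l ∈ Finset.range L, a m l‖) ^ 2 := by gcongr
      _ ≤ _ := h6
      _ ≤ 2 * D * (L * (w 0 + 2 * ∑ r ∈ Finset.Ico 1 L, w r)) := by gcongr
      _ ≤ _ := by gcongr
  have h8 : (L : ℝ) ^ 2 * ‖∑ n ∈ Finset.range M, z n‖ ^ 2 ≤
      (L : ℝ) ^ 2 * (2 * D / L * (D + 2 * ∑ r ∈ Finset.Ico 1 L, w r)) := by
    calc _ = (L * ‖∑ n ∈ Finset.range M, z n‖) ^ 2 := by ring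
      _ ≤ _ := h7
      _ = _ := by field_simp
  exact le_of_mul_le_mul_left h8 (by positivity)

lemma dvd_second_difference {K B q : ℕ} (hK : B * q = K) {v d a e : ℤ} (hB : (B : ℤ) ∣ a)
    (hq : (q : ℤ) ∣ e) {c₀ c₁ c₂ c₃ : ℤ} (h₀ : c₀ * d ^ 2 ≡ v [ZMOD K])
    (h₁ : c₁ * (d + a) ^ 2 ≡ v [ZMOD K]) (h₂ : c₂ * (d + e) ^ 2 ≡ v [ZMOD K])
    (h₃ : c₃ * (d + e + a) ^ 2 ≡ v [ZMOD K]) (g₀ : IsCoprime d K) (g₁ : IsCoprime (d + a) K)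
    (g₂ : IsCoprime (d + e) K) (g₃ : IsCoprime (d + e + a) K) :
    (K : ℤ) ∣ c₃ - c₂ - (c₁ - c₀) := by
  have hKz : (K : ℤ) = B * q := by rw [← hK]; push_cast; ring
  obtain ⟨k₀, hk₀⟩ := h₀.symm.dvd
  obtain ⟨k₁, hk₁⟩ := h₁.symm.dvd
  obtain ⟨k₂, hk₂⟩ := h₂.symm.dvd
  obtain ⟨k₃, hk₃⟩ := h₃.symm.dvd
  obtain ⟨a', rfl⟩ := hB
  obtain ⟨e', rfl⟩ := hq
  set P := d ^ 2 * (d + B * a') ^ 2 with hP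
  set P' := (d + q * e') ^ 2 * (d + q * e' + B * a') ^ 2 with hP'
  have hPc : IsCoprime P K := (g₀.pow_left).mul_left g₁.pow_left
  have hPc' : IsCoprime P' K := (g₂.pow_left).mul_left g₃.pow_left
  have hBd : (B : ℤ) ∣ c₃ - c₂ := by
    have hBc : IsCoprime P' (B : ℤ) := hPc'.of_isCoprime_of_dvd_right ⟨q, hKz⟩
    refine hBc.symm.dvd_of_dvd_mul_left (z := c₃ - c₂) ?_
    refine ⟨-v * a' * (2 * (d + q * e') + B * a') + q * (k₃ * (d + q * e') ^ 2
      - k₂ * (d + q * e' + B * a') ^ 2), ?_⟩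
    rw [hKz] at hk₂ hk₃
    linear_combination (d + q * e') ^ 2 * hk₃ - (d + q * e' + B * a') ^ 2 * hk₂
  obtain ⟨f, hf⟩ := hBd
  have hPP : (q : ℤ) ∣ P' - P := by
    have h1 : (d + q * e') ≡ d [ZMOD q] := by simp
    have h2 : P' ≡ P [ZMOD q] := (h1.pow 2).mul ((h1.add_right _).pow 2)
    exact h2.symm.dvd
  obtain ⟨p, hp⟩ := hPP
  refine hPc.symm.dvd_of_dvd_mul_left (z := c₃ - c₂ - (c₁ - c₀)) ?_
  refine ⟨k₃ * (d + q * e') ^ 2 - k₂ * (d + q * e' + B * a') ^ 2 - k₁ * d ^ 2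
    + k₀ * (d + B * a') ^ 2 - 2 * v * a' * e' - p * f, ?_⟩
  have : P = P' - q * p := by linarith
  have e1 : P * (c₃ - c₂) = P' * (c₃ - c₂) - q * p * (B * f) := by rw [← hf, this]; ring
  rw [mul_sub, e1, hKz]
  rw [hKz] at hk₀ hk₁ hk₂ hk₃
  linear_combination (d + q * e') ^ 2 * hk₃ - (d + q * e' + B * a') ^ 2 * hk₂
    - d ^ 2 * hk₁ + (d + B * a') ^ 2 * hk₀

open Classical in
lemma card_near_int_le (f : ℕ → ℝ) (M H D : ℕ) (hH : 0 < H) (hM : M ≤ D) :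
    (H : ℝ) * ((Finset.range M).filter fun t => ∃ k : ℤ, |f t - k| ≤ 1 / (8 * H)).card ≤
      4 * (D + 2 * ∑ h ∈ Finset.Ico 1 H, ‖∑ t ∈ Finset.range M, unitExp (h * f t)‖) := by
  have hH' : (0 : ℝ) < H := by exact_mod_cast hH
  set w : ℕ → ℝ := fun h => ‖∑ t ∈ Finset.range M, unitExp (h * f t)‖ with hw
  have h1 : ∀ j r, j + r < H → ‖∑ t ∈ Finset.range M, unitExp ((j + r : ℕ) * f t) *
      (starRingEnd ℂ) (unitExp (j * f t))‖ ≤ w r := by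
    intro j r _
    apply le_of_eq
    simp only [hw]
    congr 1
    refine Finset.sum_congr rfl fun t _ => ?_
    rw [unitExp_mul_conj]
    congr 1
    push_cast
    ring
  have h2 := sum_norm_sq_sum_le _ H (fun t h => unitExp (h * f t)) w h1 fun _ => norm_nonneg _
  have h3 : w 0 ≤ D := by
    refine (norm_sum_le _ _).trans ?_
    simpa [norm_unitExp] using hM
  have h4 : ∀ t ∈ (Finset.range M).filter fun t => ∃ k : ℤ, |f t - k| ≤ 1 / (8 * H),
      ((H : ℝ) / 2) ^ 2 ≤ ‖∑ l ∈ Finset.range H, unitExp (l * f t)‖ ^ 2 := by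
    intro t ht
    obtain ⟨_, k, hk⟩ := Finset.mem_filter.1 ht
    refine pow_le_pow_left₀ (by positivity) ?_ 2
    refine le_trans ?_ (Complex.re_le_norm _)
    rw [Complex.re_sum]
    calc (H : ℝ) / 2 = ∑ l ∈ Finset.range H, (1 / 2 : ℝ) := by simp; ring
      _ ≤ _ := by
        refine Finset.sum_le_sum fun l hl => ?_
        have hl' : (l : ℝ) ≤ H := by exact_mod_cast (Finset.mem_range.1 hl).le
        have e1 : unitExp (l * f t) = unitExp (l * (f t - k)) := by
          rw [← unitExp_nat_mul_add_int l (f t - k) k]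
          congr 2
          ring
        rw [e1]
        unfold unitExp
        rw [Complex.exp_ofReal_mul_I_re]
        refine le_trans ?_ (Real.one_sub_sq_div_two_le_cos)
        have e2 : |l * (f t - k)| ≤ 1 / 8 := by
          rw [abs_mul, Nat.abs_cast]
          calc (l : ℝ) * |f t - k| ≤ H * (1 / (8 * H)) := by gcongr
            _ = 1 / 8 := by field_simp
        have e3 : (l * (f t - k)) ^ 2 ≤ (1 / 8) ^ 2 := by
          rw [← sq_abs]; gcongr
        have e4 : Real.pi ^ 2 ≤ 16 := by nlinarith [Real.pi_le_four, Real.pi_pos]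
        have e5 : (2 * Real.pi * (l * (f t - k))) ^ 2 ≤ 1 := by
          calc _ = 4 * Real.pi ^ 2 * (l * (f t - k)) ^ 2 := by ring
            _ ≤ 4 * 16 * (1 / 8) ^ 2 := by gcongr
            _ = 1 := by norm_num
        linarith
  have h5 := Finset.card_nsmul_le_sum _ _ _ h4
  have h6 := Finset.sum_le_sum_of_subset_of_nonneg
    (Finset.filter_subset (fun t => ∃ k : ℤ, |f t - k| ≤ 1 / (8 * H)) (Finset.range M))
    (f := fun t => ‖∑ l ∈ Finset.range H, unitExp (l * f t)‖ ^ 2) fun _ _ _ => sq_nonneg _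
  rw [nsmul_eq_mul] at h5
  have h7 : (H : ℝ) * (w 0 + 2 * ∑ r ∈ Finset.Ico 1 H, w r) ≤
      H * (D + 2 * ∑ r ∈ Finset.Ico 1 H, w r) := by gcongr
  refine le_of_mul_le_mul_left ?_ hH'
  have h8 := h5.trans (h6.trans (h2.trans h7))
  linarith

lemma invPowDiff_cons (n : ℕ) (h : ℝ) (hs : List ℝ) (y : ℝ) :
    invPowDiff n (h :: hs) y = invPowDiff n hs (y + h) - invPowDiff n hs y := rfl

/-- The phase `h (c(t)/K - A/(K(d₀+bt)²))`. -/
noncomputable def hybridPhase (b d₀ K h : ℕ) (A : ℝ) (c : ℕ → ℤ) (t : ℕ) : ℝ :=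
  h * (c t / K - A / (K * (d₀ + b * t) ^ 2))

lemma norm_sum_second_difference_le {b d₀ D M P Q K h l s : ℕ} {A : ℝ} {c : ℕ → ℤ} {v : ℤ}
    (hb : 0 < b) (hD : 0 < D) (hP : 0 < P) (hQ : 0 < Q) (hh : 0 < h) (hl : 0 < l) (hs : 0 < s)
    (hA : 0 < A) (hK : b * P * (b * Q) = K) (hd₀ : D ≤ d₀) (hM : d₀ + b * M ≤ 3 * D)
    (hsmall : 48 * (h * A * b * l * s) ≤ (D : ℝ) ^ 5)
    (hc : ∀ t < M, c t * (d₀ + b * t) ^ 2 ≡ v [ZMOD K])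
    (hcop : ∀ t < M, IsCoprime ((d₀ : ℤ) + b * t) K) :
    ‖∑ t ∈ Finset.range (M - P * l - Q * s),
      (unitExp (hybridPhase b d₀ K h A c (t + Q * s + P * l)) *
        (starRingEnd ℂ) (unitExp (hybridPhase b d₀ K h A c (t + Q * s)))) *
      (starRingEnd ℂ) (unitExp (hybridPhase b d₀ K h A c (t + P * l)) *
        (starRingEnd ℂ) (unitExp (hybridPhase b d₀ K h A c t)))‖ ≤
      3 / (24 * (h * A * b * l * s) / (3 * D) ^ 5) := by
  have hKpos : 0 < K := by rw [← hK]; positivity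
  have hKr : (K : ℝ) = b * P * (b * Q) := by rw [← hK]; push_cast; ring
  have hK0 : (0 : ℝ) < K := by exact_mod_cast hKpos
  have hbr : (0 : ℝ) < b := by exact_mod_cast hb
  have hPr : (0 : ℝ) < P := by exact_mod_cast hP
  have hQr : (0 : ℝ) < Q := by exact_mod_cast hQ
  have hlr : (0 : ℝ) < l := by exact_mod_cast hl
  have hsr : (0 : ℝ) < s := by exact_mod_cast hs
  have hhr : (0 : ℝ) < h := by exact_mod_cast hh
  have hDr : (0 : ℝ) < D := by exact_mod_cast hD
  have hd₀r : (D : ℝ) ≤ d₀ := by exact_mod_cast hd₀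
  set a₁ : ℝ := b * Q * s with ha₁
  set a₂ : ℝ := b * P * l with ha₂
  have ha₁0 : 0 < a₁ := by positivity
  have ha₂0 : 0 < a₂ := by positivity
  have hy : ∀ t : ℕ, (0 : ℝ) < d₀ + b * t := fun t =>
    add_pos_of_pos_of_nonneg (hDr.trans_le hd₀r) (by positivity)
  set g : ℕ → ℝ := fun t => -(h * A / K) * invPowDiff 2 [a₁, a₂] (d₀ + b * t) with hg
  set N := M - P * l - Q * s with hN
  have hterm : ∀ t ∈ Finset.range N,
      (unitExp (hybridPhase b d₀ K h A c (t + Q * s + P * l)) *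
        (starRingEnd ℂ) (unitExp (hybridPhase b d₀ K h A c (t + Q * s)))) *
      (starRingEnd ℂ) (unitExp (hybridPhase b d₀ K h A c (t + P * l)) *
        (starRingEnd ℂ) (unitExp (hybridPhase b d₀ K h A c t))) = unitExp (g t) := by
    intro t ht
    rw [Finset.mem_range] at ht
    rw [unitExp_mul_conj, unitExp_mul_conj, unitExp_mul_conj]
    obtain ⟨k, hk⟩ : (K : ℤ) ∣ c (t + Q * s + P * l) - c (t + Q * s) - (c (t + P * l) - c t) := by
      have ht0 : t < M := by omega
      have ht1 : t + P * l < M := by omega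
      have ht2 : t + Q * s < M := by omega
      have ht3 : t + Q * s + P * l < M := by omega
      have e1 : (d₀ : ℤ) + b * ((t + P * l : ℕ) : ℤ) = d₀ + b * t + b * P * l := by
        push_cast; ring
      have e2 : (d₀ : ℤ) + b * ((t + Q * s : ℕ) : ℤ) = d₀ + b * t + b * Q * s := by
        push_cast; ring
      have e3 : (d₀ : ℤ) + b * ((t + Q * s + P * l : ℕ) : ℤ) =
          d₀ + b * t + b * Q * s + b * P * l := by
        push_cast; ring
      have c1 := hc _ ht1
      have c2 := hc _ ht2
      have c3 := hc _ ht3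
      have g1 := hcop _ ht1
      have g2 := hcop _ ht2
      have g3 := hcop _ ht3
      rw [e1] at c1 g1
      rw [e2] at c2 g2
      rw [e3] at c3 g3
      exact dvd_second_difference hK ⟨l, by push_cast; ring⟩ ⟨s, by push_cast; ring⟩
        (hc _ ht0) c1 c2 c3 (hcop _ ht0) g1 g2 g3
    have hkr : (c (t + Q * s + P * l) : ℝ) - c (t + Q * s) - (c (t + P * l) - c t) = K * k := by
      exact_mod_cast hk
    rw [← unitExp_add_int (g t) (h * k)]
    congr 1
    have hdiv : ∀ u : ℝ, A / (K * u) = A / K * (1 / u) := fun u => by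
      rw [div_mul_div_comm, mul_one]
    simp only [hg, invPowDiff, hybridPhase]
    push_cast
    rw [show (d₀ : ℝ) + b * (t + Q * s + P * l) = d₀ + b * t + a₁ + a₂ by rw [ha₁, ha₂]; ring,
      show (d₀ : ℝ) + b * (t + Q * s) = d₀ + b * t + a₁ by rw [ha₁]; ring,
      show (d₀ : ℝ) + b * (t + P * l) = d₀ + b * t + a₂ by rw [ha₂]; ring]
    have hkk : (k : ℝ) =
      ((c (t + Q * s + P * l) : ℝ) - c (t + Q * s) - (c (t + P * l) - c t)) / K := by
      rw [hkr]; field_simp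
    rw [hkk]
    simp only [hdiv]
    ring
  have hstep : ∀ t : ℕ, g (t + 1) - g t =
      -(h * A / K) * invPowDiff 2 [(b : ℝ), a₁, a₂] (d₀ + b * t) := by
    intro t
    simp only [hg]
    rw [invPowDiff_cons 2 b [a₁, a₂]]
    push_cast
    rw [show (d₀ : ℝ) + b * (t + 1) = d₀ + b * t + b by ring]
    ring
  have hvalue : ∀ t < N, ∃ η : ℝ, D ≤ η ∧ η ≤ 3 * D ∧
      g (t + 1) - g t = 24 * (h * A * b * l * s) / η ^ 5 := by
    intro t ht
    obtain ⟨η, h1, h2, h3⟩ := exists_invPowDiff_eq 2 [(b : ℝ), a₁, a₂] (by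
      intro x hx
      simp only [List.mem_cons, List.not_mem_nil, or_false] at hx
      rcases hx with hx | hx | hx <;> rw [hx] <;> assumption)
      (d₀ + b * t) (hy t)
    have hη : 0 < η := (hy t).trans_le h1
    refine ⟨η, by nlinarith [show (0 : ℝ) ≤ b * t by positivity], ?_, ?_⟩
    · refine h2.trans ?_
      have : b * (t + 1 + Q * s + P * l) ≤ b * M := Nat.mul_le_mul_left _ (by omega)
      have : d₀ + b * (t + 1 + Q * s + P * l) ≤ 3 * D := by omega
      have : (d₀ : ℝ) + b * (t + 1 + Q * s + P * l) ≤ 3 * D := by exact_mod_cast this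
      simp only [List.sum_cons, List.sum_nil, ha₁, ha₂]
      linarith
    · rw [hstep, h3, hKr, ha₁, ha₂]
      simp only [List.length_cons, List.length_nil, List.prod_cons, List.prod_nil]
      norm_num [Nat.ascFactorial]
      field_simp
  rw [Finset.sum_congr rfl hterm]
  apply kusmin_landau
  · positivity
  · intro t ht
    obtain ⟨η, h1, h2, h3⟩ := hvalue t ht
    have : 0 < η := hDr.trans_le h1
    rw [h3]
    gcongr
  · intro t ht
    obtain ⟨η, h1, h2, h3⟩ := hvalue t ht
    have hη : 0 < η := hDr.trans_le h1
    rw [h3, div_le_iff₀ (by positivity)]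
    have : (D : ℝ) ^ 5 ≤ η ^ 5 := by gcongr
    linarith
  · intro t ht
    rw [← sub_nonpos]
    have e : g (t + 2) - g (t + 1) - (g (t + 1) - g t) =
        -(h * A / K) * invPowDiff 2 [(b : ℝ), b, a₁, a₂] (d₀ + b * t) := by
      rw [show t + 2 = t + 1 + 1 by ring, hstep, hstep, invPowDiff_cons 2 b [(b : ℝ), a₁, a₂]]
      push_cast
      rw [show (d₀ : ℝ) + b * (t + 1) = d₀ + b * t + b by ring]
      ring
    obtain ⟨η, h1, -, h3⟩ := exists_invPowDiff_eq 2 [(b : ℝ), b, a₁, a₂]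
      (by
        intro x hx
        simp only [List.mem_cons, List.not_mem_nil, or_false] at hx
        rcases hx with hx | hx | hx | hx <;> rw [hx] <;> assumption) (d₀ + b * t) (hy t)
    have hη : 0 < η := (hy t).trans_le h1
    rw [e, h3, neg_mul, neg_nonpos]
    simp only [List.length_cons, List.length_nil, List.prod_cons, List.prod_nil]
    norm_num
    positivity

lemma norm_sum_hybridPhase_sq_le {b d₀ D M P Q K h L S : ℕ} {A : ℝ} {c : ℕ → ℤ} {v : ℤ}
    (hb : 0 < b) (hD : 0 < D) (hP : 0 < P) (hQ : 0 < Q) (hh : 0 < h) (hL : 0 < L) (hS : 0 < S)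
    (hA : 0 < A) (hK : b * P * (b * Q) = K) (hd₀ : D ≤ d₀) (hM : d₀ + b * M ≤ 3 * D)
    (hsmall : 48 * (h * A * b * L * S) ≤ (D : ℝ) ^ 5) (hMD : M ≤ D) (hPL : P * L ≤ D)
    (hQS : Q * S ≤ D) (hc : ∀ t < M, c t * (d₀ + b * t) ^ 2 ≡ v [ZMOD K])
    (hcop : ∀ t < M, IsCoprime ((d₀ : ℤ) + b * t) K) :
    ∃ E : ℝ, 0 ≤ E ∧
      ‖∑ t ∈ Finset.range M, unitExp (hybridPhase b d₀ K h A c t)‖ ^ 2 ≤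
        2 * D / L * (D + 2 * E) ∧
      E ^ 2 ≤ 2 * D * L / S * (L * D + 62 * D ^ 5 / A *
        ((∑ l ∈ Finset.Ico 1 L, 1 / (l : ℝ)) * ∑ s ∈ Finset.Ico 1 S, 1 / (s : ℝ))) := by
  have hbr : (1 : ℝ) ≤ b := by exact_mod_cast hb
  have hhr : (1 : ℝ) ≤ h := by exact_mod_cast hh
  have hDr : (0 : ℝ) < D := by exact_mod_cast hD
  have hLr : (0 : ℝ) < L := by exact_mod_cast hL
  have hSr : (0 : ℝ) < S := by exact_mod_cast hS
  set z : ℕ → ℂ := fun t => unitExp (hybridPhase b d₀ K h A c t) with hz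
  set T : ℕ → ℝ := fun l => ‖∑ n ∈ Finset.range (M - P * l), z (n + P * l) *
    (starRingEnd ℂ) (z n)‖ with hT
  refine ⟨∑ l ∈ Finset.Ico 1 L, T l, Finset.sum_nonneg fun _ _ => norm_nonneg _,
    weyl_vanDerCorput z (fun n => (norm_unitExp _).le) M P L D hL hMD hPL, ?_⟩
  have h1 : ∀ l ∈ Finset.Ico 1 L, T l ^ 2 ≤ 2 * D / S * (D + 2 * ∑ s ∈ Finset.Ico 1 S,
      31 * D ^ 5 / A * (1 / (l : ℝ) * (1 / (s : ℝ)))) := by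
    intro l hl
    rw [Finset.mem_Ico] at hl
    refine (weyl_vanDerCorput (fun n => z (n + P * l) * (starRingEnd ℂ) (z n)) (fun n => ?_)
      (M - P * l) Q S D hS (by omega) hQS).trans ?_
    · rw [norm_mul, RCLike.norm_conj, norm_unitExp, norm_unitExp, mul_one]
    gcongr with s hs
    rw [Finset.mem_Ico] at hs
    have hlr : (0 : ℝ) < l := by exact_mod_cast hl.1
    have hsr : (0 : ℝ) < s := by exact_mod_cast hs.1
    have hlL : (l : ℝ) ≤ L := by exact_mod_cast hl.2.le
    have hsS : (s : ℝ) ≤ S := by exact_mod_cast hs.2.le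
    have h2 := norm_sum_second_difference_le hb hD hP hQ hh hl.1 hs.1 hA hK hd₀ hM
      (le_trans (by gcongr) hsmall) hc hcop
    refine h2.trans ?_
    have h3 : 3 / (24 * (h * A * b * l * s) / (3 * D) ^ 5) =
        (729 / 24) * D ^ 5 / (h * b * A) * (1 / (l : ℝ) * (1 / (s : ℝ))) := by
      have : (0 : ℝ) < h := by linarith
      have : (0 : ℝ) < b := by linarith
      field_simp
      ring
    rw [h3]
    have h4 : A ≤ h * b * A := by
      have : 1 ≤ (h : ℝ) * b := one_le_mul_of_one_le_of_one_le hhr hbr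
      nlinarith
    gcongr
    norm_num
  have h2 := sq_sum_le_card_mul_sum_sq (s := Finset.Ico 1 L) (f := T)
  have h3 : ((Finset.Ico 1 L).card : ℝ) ≤ L := by
    rw [Nat.card_Ico]; exact_mod_cast Nat.sub_le _ _
  calc _ ≤ _ := h2
    _ ≤ (L : ℝ) * ∑ l ∈ Finset.Ico 1 L, 2 * (D : ℝ) / S * (D + 2 * ∑ s ∈ Finset.Ico 1 S,
      31 * (D : ℝ) ^ 5 / A * (1 / (l : ℝ) * (1 / (s : ℝ)))) :=
        mul_le_mul h3 (Finset.sum_le_sum h1) (Finset.sum_nonneg fun _ _ => sq_nonneg _) hLr.le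
    _ = (L : ℝ) * (2 * (D : ℝ) / S * ((Finset.Ico 1 L).card * D + 62 * D ^ 5 / A *
        ((∑ l ∈ Finset.Ico 1 L, 1 / (l : ℝ)) * ∑ s ∈ Finset.Ico 1 S, 1 / (s : ℝ)))) := by
        simp_rw [← Finset.mul_sum]
        rw [Finset.sum_add_distrib, Finset.sum_const, nsmul_eq_mul, ← Finset.mul_sum,
          ← Finset.mul_sum, ← Finset.sum_mul]
        ring
    _ ≤ (L : ℝ) * (2 * (D : ℝ) / S * (L * D + 62 * D ^ 5 / A *
        ((∑ l ∈ Finset.Ico 1 L, 1 / (l : ℝ)) * ∑ s ∈ Finset.Ico 1 S, 1 / (s : ℝ)))) := by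
        gcongr
    _ = _ := by ring

open Classical in
lemma card_hybridPhase_near_int_le {b d₀ D M P Q K y : ℕ} {A : ℝ} {c : ℕ → ℤ} {v : ℤ}
    (hb : 0 < b) (hP : 0 < P) (hQ : 0 < Q) (hK : b * P * (b * Q) = K) (hd₀ : D ≤ d₀)
    (hM : d₀ + b * M ≤ 3 * D) (hMD : M ≤ D) (hPL : P * y ^ 42 ≤ D) (hQS : Q * y ^ 87 ≤ D)
    (hc : ∀ t < M, c t * (d₀ + b * t) ^ 2 ≡ v [ZMOD K])
    (hcop : ∀ t < M, IsCoprime ((d₀ : ℤ) + b * t) K)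
    (hy : 48 * b ≤ y) (hDlo : y ^ 230 ≤ D) (hDhi : D ≤ y ^ 259)
    (hAlo : (y : ℝ) ^ 983 ≤ A) (hAhi : A ≤ (y : ℝ) ^ 1001)
    (hlog : (∑ l ∈ Finset.Ico 1 (y ^ 42), 1 / (l : ℝ)) * ∑ s ∈ Finset.Ico 1 (y ^ 87), 1 / (s : ℝ)
      ≤ y) :
    (y : ℝ) ^ 18 * ((Finset.range M).filter fun t => ∃ k : ℤ,
      |(c t / K - A / (K * (d₀ + b * t) ^ 2)) - k| ≤ 1 / (8 * ((y ^ 18 : ℕ) : ℝ))).card ≤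
      28 * D := by
  have hy48 : 48 ≤ y := le_trans (by omega) hy
  have hyr : (48 : ℝ) ≤ y := by exact_mod_cast hy48
  have hy0 : (0 : ℝ) < y := by linarith
  have hyb : (48 : ℝ) * b ≤ y := by exact_mod_cast hy
  have hypos : 0 < y := by omega
  have hD : 0 < D := lt_of_lt_of_le (by positivity) hDlo
  have hDr : (0 : ℝ) < D := by exact_mod_cast hD
  have hDlor : (y : ℝ) ^ 230 ≤ D := by exact_mod_cast hDlo
  have hDhir : (D : ℝ) ≤ (y : ℝ) ^ 259 := by exact_mod_cast hDhi
  have hA : 0 < A := lt_of_lt_of_le (by positivity) hAlo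
  have hsum : ∀ h ∈ Finset.Ico 1 (y ^ 18),
      ‖∑ t ∈ Finset.range M, unitExp (h * (c t / K - A / (K * (d₀ + b * t) ^ 2)))‖ ≤
        3 * D / (y : ℝ) ^ 18 := by
    intro h hh
    rw [Finset.mem_Ico] at hh
    have hhr : (h : ℝ) ≤ (y : ℝ) ^ 18 := by exact_mod_cast hh.2.le
    have hsmall : 48 * (h * A * b * ((y ^ 42 : ℕ) : ℝ) * ((y ^ 87 : ℕ) : ℝ)) ≤ (D : ℝ) ^ 5 := by
      push_cast
      calc 48 * (h * A * b * (y : ℝ) ^ 42 * (y : ℝ) ^ 87) =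
            (48 * b) * h * A * (y : ℝ) ^ 42 * (y : ℝ) ^ 87 := by ring
        _ ≤ y * (y : ℝ) ^ 18 * (y : ℝ) ^ 1001 * (y : ℝ) ^ 42 * (y : ℝ) ^ 87 := by gcongr
        _ = (y : ℝ) ^ 1149 := by ring
        _ ≤ (y : ℝ) ^ 1150 := by gcongr <;> linarith
        _ = ((y : ℝ) ^ 230) ^ 5 := by ring
        _ ≤ _ := by gcongr
    obtain ⟨E, hE0, h1, h2⟩ := norm_sum_hybridPhase_sq_le hb hD hP hQ hh.1
      (pow_pos hypos 42) (pow_pos hypos 87) hA hK hd₀ hM hsmall hMD hPL hQS hc hcop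
    push_cast at h1 h2
    have hE : E ≤ (y : ℝ) ^ 42 * D / (y : ℝ) ^ 36 := by
      refine le_of_sq_le_sq ?_ (by positivity)
      have h3 : (D : ℝ) ^ 4 / A ≤ (y : ℝ) ^ 53 := by
        rw [div_le_iff₀ hA]
        calc (D : ℝ) ^ 4 ≤ ((y : ℝ) ^ 259) ^ 4 := by gcongr
          _ = (y : ℝ) ^ 53 * (y : ℝ) ^ 983 := by ring
          _ ≤ _ := by gcongr
      calc E ^ 2 ≤ 2 * D * (y : ℝ) ^ 42 / (y : ℝ) ^ 87 * ((y : ℝ) ^ 42 * D + 62 * D ^ 5 / A * y) := by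
            refine h2.trans ?_
            gcongr
        _ = D ^ 2 * (2 / (y : ℝ) ^ 3 + 124 * (D ^ 4 / A) / (y : ℝ) ^ 44) := by
            field_simp
            ring
        _ ≤ D ^ 2 * (2 / (y : ℝ) ^ 3 + 124 * (y : ℝ) ^ 53 / (y : ℝ) ^ 44) := by gcongr
        _ ≤ D ^ 2 * (y : ℝ) ^ 12 := by
            gcongr
            have e1 : 124 * (y : ℝ) ^ 53 / (y : ℝ) ^ 44 = 124 * (y : ℝ) ^ 9 := by
              field_simp
            have e2 : 2 / (y : ℝ) ^ 3 ≤ (y : ℝ) ^ 9 := by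
              rw [div_le_iff₀ (by positivity)]
              have : (1 : ℝ) ≤ (y : ℝ) ^ 11 := one_le_pow₀ (by linarith)
              calc (2 : ℝ) ≤ y := by linarith
                _ ≤ y * (y : ℝ) ^ 11 := le_mul_of_one_le_right hy0.le this
                _ = _ := by ring
            have e3 : (125 : ℝ) ≤ (y : ℝ) ^ 3 := by
              calc (125 : ℝ) ≤ 48 ^ 3 := by norm_num
                _ ≤ _ := by gcongr
            calc _ ≤ (y : ℝ) ^ 9 + 124 * (y : ℝ) ^ 9 := by rw [e1]; gcongr
              _ = 125 * (y : ℝ) ^ 9 := by ring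
              _ ≤ (y : ℝ) ^ 3 * (y : ℝ) ^ 9 := by gcongr
              _ = _ := by ring
        _ = _ := by field_simp
    refine le_of_sq_le_sq ?_ (by positivity)
    calc _ ≤ 2 * D / (y : ℝ) ^ 42 * (D + 2 * E) := h1
      _ ≤ 2 * D / (y : ℝ) ^ 42 * (D + 2 * ((y : ℝ) ^ 42 * D / (y : ℝ) ^ 36)) := by gcongr
      _ = D ^ 2 / (y : ℝ) ^ 36 * (2 / (y : ℝ) ^ 6 + 4) := by field_simp; ring
      _ ≤ D ^ 2 / (y : ℝ) ^ 36 * 9 := by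
          gcongr
          have : 2 / (y : ℝ) ^ 6 ≤ 1 := by
            rw [div_le_one (by positivity)]
            have : (1 : ℝ) ≤ (y : ℝ) ^ 5 := one_le_pow₀ (by linarith)
            nlinarith
          linarith
      _ = _ := by field_simp; ring
  have hmain := card_near_int_le (fun t => c t / K - A / (K * (d₀ + b * t) ^ 2)) M (y ^ 18) D
    (pow_pos hypos 18) hMD
  push_cast at hmain ⊢
  refine hmain.trans ?_
  have := Finset.sum_le_sum hsum
  rw [Finset.sum_const, nsmul_eq_mul, Nat.card_Ico] at this
  have h18 : ((y ^ 18 - 1 : ℕ) : ℝ) ≤ (y : ℝ) ^ 18 := by exact_mod_cast Nat.sub_le _ _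
  have h3D : ((y ^ 18 - 1 : ℕ) : ℝ) * (3 * D / (y : ℝ) ^ 18) ≤ 3 * D := by
    calc _ ≤ (y : ℝ) ^ 18 * (3 * D / (y : ℝ) ^ 18) := by gcongr
      _ = 3 * D := by field_simp
  linarith

lemma card_le_of_dvd_square_of_mod_eq {b k D P Q y U H v : ℕ} (S : Finset ℕ)
    (hb : 2 ≤ b) (hP : 0 < P) (hQ : 0 < Q) (hK : b * P * (b * Q) = b ^ k)
    (hPL : P * y ^ 42 ≤ D) (hQS : Q * y ^ 87 ≤ D)
    (hy : 48 * b ≤ y) (hDlo : y ^ 230 ≤ D) (hDhi : D ≤ y ^ 259)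
    (hUlo : y ^ 983 ≤ U) (hUhi : U ≤ y ^ 1001) (hH : 8 * y ^ 18 * H ≤ D ^ 2 * b ^ k)
    (hlog : (∑ l ∈ Finset.Ico 1 (y ^ 42), 1 / (l : ℝ)) * ∑ s ∈ Finset.Ico 1 (y ^ 87), 1 / (s : ℝ)
      ≤ y)
    (hS : ∀ n ∈ S, U ≤ n ∧ n < U + H ∧ n % b ^ k = v ∧ n.Coprime b ∧
      ∃ d, D ≤ d ∧ d ≤ 2 * D ∧ d ^ 2 ∣ n) :
    y ^ 18 * S.card ≤ 28 * b * D := by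
  classical
  have hypos : 0 < y := by omega
  have hyD : 2 * b ≤ D := by
    calc 2 * b ≤ y ^ 1 := by rw [pow_one]; omega
      _ ≤ y ^ 230 := Nat.pow_le_pow_right hypos (by norm_num)
      _ ≤ D := hDlo
  have hD : 0 < D := by omega
  have hKpos : 0 < b ^ k := by positivity
  have h18 : 1 ≤ y ^ 18 := Nat.one_le_pow _ _ hypos
  choose! d hd1 hd2 hd3 using fun n hn => (hS n hn).2.2.2.2
  set r : ℕ → ℕ := fun n => (d n - D) % b with hr
  set τ : ℕ → ℕ := fun n => (d n - D) / b with hτ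
  have hdec : ∀ n ∈ S, d n = D + r n + b * τ n := by
    intro n hn
    have := Nat.mod_add_div (d n - D) b
    have := hd1 n hn
    simp only [hr, hτ]
    omega
  have hdcop : ∀ n ∈ S, (d n).Coprime b := fun n hn =>
    (hS n hn).2.2.2.1.coprime_dvd_left ((dvd_pow_self _ two_ne_zero).trans (hd3 n hn))
  have hinj : ∀ n ∈ S, ∀ n' ∈ S, d n = d n' → n = n' := by
    intro n hn n' hn' h
    obtain ⟨hn1, hn2, hn3, -, -⟩ := hS n hn
    obtain ⟨hn1', hn2', hn3', -, -⟩ := hS n' hn'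
    have e1 : ((b ^ k : ℕ) : ℤ) ∣ (n' : ℤ) - n := Nat.modEq_iff_dvd.1 (hn3.trans hn3'.symm)
    have e2 : ((d n ^ 2 : ℕ) : ℤ) ∣ (n' : ℤ) - n :=
      dvd_sub (Int.natCast_dvd_natCast.2 (h ▸ hd3 n' hn')) (Int.natCast_dvd_natCast.2 (hd3 n hn))
    have e3 : IsCoprime ((d n ^ 2 : ℕ) : ℤ) ((b ^ k : ℕ) : ℤ) :=
      Nat.isCoprime_iff_coprime.2 ((hdcop n hn).pow 2 k)
    have e4 := e3.mul_dvd e2 e1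
    have e5 : H ≤ d n ^ 2 * b ^ k := by
      calc H ≤ 8 * y ^ 18 * H := Nat.le_mul_of_pos_left _ (by omega)
        _ ≤ D ^ 2 * b ^ k := hH
        _ ≤ _ := by gcongr; exact hd1 n hn
    have e6 : (n' : ℤ) - n = 0 := by
      refine Int.eq_zero_of_abs_lt_dvd e4 ?_
      have : (H : ℤ) ≤ ((d n ^ 2 : ℕ) : ℤ) * ((b ^ k : ℕ) : ℤ) := by exact_mod_cast e5
      refine lt_of_lt_of_le ?_ this
      rw [abs_lt]
      omega
    omega
  have hclass : ∀ ρ ∈ Finset.range b,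
      y ^ 18 * (S.filter fun n => r n = ρ).card ≤ 28 * D := by
    intro ρ hρ
    rw [Finset.mem_range] at hρ
    rcases (S.filter fun n => r n = ρ).eq_empty_or_nonempty with he | ⟨n₀, hn₀⟩
    · simp [he]
    rw [Finset.mem_filter] at hn₀
    have hcopb : ∀ t : ℕ, IsCoprime (((D + ρ : ℕ) : ℤ) + b * t) ((b ^ k : ℕ) : ℤ) := by
      intro t
      have h1 : IsCoprime ((d n₀ : ℤ)) b := Nat.isCoprime_iff_coprime.2 (hdcop n₀ hn₀.1)
      have h2 : ((D + ρ : ℕ) : ℤ) + b * t = d n₀ + b * (t - τ n₀) := by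
        rw [hdec n₀ hn₀.1, hn₀.2]; push_cast; ring
      rw [h2]
      push_cast
      exact (h1.add_mul_left_left _).pow_right
    have hex : ∀ t : ℕ, ∃ c : ℤ, c * (((D + ρ : ℕ) : ℤ) + b * t) ^ 2 ≡ v [ZMOD (b ^ k : ℕ)] := by
      intro t
      obtain ⟨x, z, hxz⟩ := (hcopb t).pow_left (m := 2)
      refine ⟨v * x, Int.modEq_iff_dvd.2 ⟨v * z, ?_⟩⟩
      linear_combination (-(v : ℤ)) * hxz
    choose c hc using hex
    have hbM : b * (D / b) ≤ D := Nat.mul_div_le D b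
    have hMD : D / b + 1 ≤ D := by
      have : D / b < D := Nat.div_lt_self hD hb
      omega
    have key := card_hybridPhase_near_int_le (A := U) (c := c) (v := v) (d₀ := D + ρ)
      (M := D / b + 1) (by omega) hP hQ hK (Nat.le_add_right _ _)
      (by rw [mul_add]; omega) hMD hPL hQS (fun t _ => hc t) (fun t _ => hcopb t) hy hDlo hDhi
      (by exact_mod_cast hUlo) (by exact_mod_cast hUhi) hlog
    have hle : (S.filter fun n => r n = ρ).card ≤ ((Finset.range (D / b + 1)).filter fun t =>
        ∃ k' : ℤ, |(c t / (b ^ k : ℕ) - (U : ℝ) / ((b ^ k : ℕ) * ((D + ρ : ℕ) + b * t) ^ 2)) - k'| ≤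
          1 / (8 * ((y ^ 18 : ℕ) : ℝ))).card := by
      refine Finset.card_le_card_of_injOn τ ?_ ?_
      · intro n hn
        simp only [Finset.coe_filter, Set.mem_ofPred_eq, Finset.mem_range] at hn ⊢
        obtain ⟨hn1, hn2, hn3, -, -⟩ := hS n hn.1
        have hdn := hdec n hn.1
        rw [hn.2] at hdn
        refine ⟨Nat.lt_succ_of_le (Nat.div_le_div_right (by have := hd2 n hn.1; omega)), ?_⟩
        obtain ⟨m, hm⟩ := hd3 n hn.1
        have hdZ : ((D + ρ : ℕ) : ℤ) + b * τ n = d n := by rw [hdn]; push_cast; ring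
        have hdR : ((D + ρ : ℕ) : ℝ) + b * τ n = d n := by rw [hdn]; push_cast; ring
        have hcn := hc (τ n)
        rw [hdZ] at hcn
        have hcopn := hcopb (τ n)
        rw [hdZ] at hcopn
        have hnv : (n : ℤ) ≡ v [ZMOD (b ^ k : ℕ)] := by
          rw [← hn3]
          exact (Int.natCast_modEq_iff.2 (Nat.mod_modEq n (b ^ k))).symm
        obtain ⟨z, hz⟩ : ((b ^ k : ℕ) : ℤ) ∣ m - c (τ n) := by
          refine (hcopn.symm.pow_right (n := 2)).dvd_of_dvd_mul_right ?_
          have := (hcn.trans hnv.symm).dvd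
          have hmZ : (n : ℤ) = (d n : ℤ) ^ 2 * m := by exact_mod_cast hm
          rw [hmZ] at this
          rwa [sub_mul, mul_comm (m : ℤ)]
        have hdpos : (0 : ℝ) < d n := by
          have := hd1 n hn.1
          exact_mod_cast (by omega : 0 < d n)
        have hKr : (0 : ℝ) < (b ^ k : ℕ) := by exact_mod_cast hKpos
        have hzR : (m : ℝ) - c (τ n) = (b ^ k : ℕ) * z := by exact_mod_cast hz
        have hmR : (n : ℝ) = (d n : ℝ) ^ 2 * m := by exact_mod_cast hm
        refine ⟨-z, ?_⟩
        rw [hdR]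
        have hval : (c (τ n) : ℝ) / (b ^ k : ℕ) - U / ((b ^ k : ℕ) * (d n : ℝ) ^ 2) - (-z : ℤ) =
            (n - U) / ((b ^ k : ℕ) * (d n : ℝ) ^ 2) := by
          rw [hmR]
          have : (c (τ n) : ℝ) = m - (b ^ k : ℕ) * z := by linarith
          rw [this]
          push_cast
          field_simp
          ring
        have hU1 : (U : ℝ) ≤ n := by exact_mod_cast hn1
        have hU2 : (n : ℝ) - U ≤ H := by
          have : (n : ℝ) ≤ U + H := by exact_mod_cast hn2.le
          linarith
        rw [hval, abs_of_nonneg (div_nonneg (by linarith) (by positivity)),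
          div_le_div_iff₀ (by positivity) (by positivity)]
        have hHr : (8 * y ^ 18 * H : ℝ) ≤ D ^ 2 * (b ^ k : ℕ) := by exact_mod_cast hH
        have hDd : (D : ℝ) ≤ d n := by exact_mod_cast hd1 n hn.1
        calc ((n : ℝ) - U) * (8 * ((y ^ 18 : ℕ) : ℝ)) ≤ H * (8 * ((y ^ 18 : ℕ) : ℝ)) := by gcongr
          _ = 8 * y ^ 18 * H := by push_cast; ring
          _ ≤ D ^ 2 * (b ^ k : ℕ) := hHr
          _ ≤ (d n : ℝ) ^ 2 * (b ^ k : ℕ) := by gcongr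
          _ = _ := by ring
      · intro n hn n' hn' h
        simp only [Finset.coe_filter, Set.mem_ofPred_eq] at hn hn'
        refine hinj n hn.1 n' hn'.1 ?_
        rw [hdec n hn.1, hdec n' hn'.1, hn.2, hn'.2, h]
    have : (y : ℝ) ^ 18 * ((S.filter fun n => r n = ρ).card : ℝ) ≤ 28 * D :=
      le_trans (by gcongr) key
    exact_mod_cast this
  have hmaps : ∀ n ∈ S, r n ∈ Finset.range b := fun n _ =>
    Finset.mem_range.2 (Nat.mod_lt _ (by omega))
  rw [Finset.card_eq_sum_card_fiberwise hmaps, Finset.mul_sum]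
  refine (Finset.sum_le_sum hclass).trans ?_
  rw [Finset.sum_const, Finset.card_range, smul_eq_mul]
  linarith

lemma mod_pow_eq_of_palindrome_of_div_pow_eq {b n n' N k : ℕ} (hb : 2 ≤ b)
    (hn : (Nat.digits b n).Palindrome) (hn' : (Nat.digits b n').Palindrome)
    (hN : (Nat.digits b n).length = N) (hN' : (Nat.digits b n').length = N) (hk : k ≤ N)
    (h : n / b ^ (N - k) = n' / b ^ (N - k)) : n % b ^ k = n' % b ^ k := by
  have key : ∀ m, (Nat.digits b m).Palindrome → (Nat.digits b m).length = N →
      (Nat.digits b m).take k = ((Nat.digits b m).drop (N - k)).reverse := by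
    intro m hm hmN
    rw [List.reverse_drop, hm.reverse_eq, hmN, Nat.sub_sub_self hk]
  rw [Nat.self_div_pow_eq_ofDigits_drop _ _ hb, Nat.self_div_pow_eq_ofDigits_drop _ _ hb] at h
  have hdrop := Nat.ofDigits_inj_of_len_eq (by omega) (by simp [hN, hN'])
    (fun l hl => Nat.digits_lt_base (by omega) (List.mem_of_mem_drop hl))
    (fun l hl => Nat.digits_lt_base (by omega) (List.mem_of_mem_drop hl)) h
  rw [Nat.self_mod_pow_eq_ofDigits_take _ _ hb, Nat.self_mod_pow_eq_ofDigits_take _ _ hb,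
    key n hn hN, key n' hn' hN', hdrop]

lemma card_palindromes_le {b N : ℕ} (S : Finset ℕ) (hb : 2 ≤ b)
    (hS : ∀ n ∈ S, (Nat.digits b n).Palindrome ∧ (Nat.digits b n).length = N) :
    S.card ≤ b ^ (N - N / 2) := by
  rw [← Finset.card_range (b ^ (N - N / 2))]
  refine Finset.card_le_card_of_injOn (fun n => n / b ^ (N / 2)) ?_ ?_
  · intro n hn
    simp only [Finset.coe_range, Set.mem_Iio]
    rw [Nat.div_lt_iff_lt_mul (by positivity), ← pow_add, Nat.sub_add_cancel (Nat.div_le_self N 2),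
      ← (hS n hn).2]
    exact Nat.lt_base_pow_length_digits hb
  · intro n hn n' hn' h
    simp only at h
    have h2 : n % b ^ (N / 2) = n' % b ^ (N / 2) := by
      refine mod_pow_eq_of_palindrome_of_div_pow_eq hb (hS n hn).1 (hS n' hn').1 (hS n hn).2
        (hS n' hn').2 (Nat.div_le_self N 2) ?_
      have : N - N / 2 = N / 2 + (N - N / 2 - N / 2) := by omega
      rw [this, pow_add, ← Nat.div_div_eq_div_mul, ← Nat.div_div_eq_div_mul, h]
    rw [← Nat.div_add_mod n (b ^ (N / 2)), ← Nat.div_add_mod n' (b ^ (N / 2)), h, h2]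

lemma exists_mul_pow_le_lt {b Z X : ℕ} (hb : 2 ≤ b) (hZ : 0 < Z) (hZX : Z ≤ X) :
    ∃ j, Z * b ^ j ≤ X ∧ X < Z * b ^ (j + 1) := by
  refine ⟨Nat.log b (X / Z), ?_, ?_⟩
  · rw [mul_comm, ← Nat.le_div_iff_mul_le hZ]
    exact Nat.pow_log_le_self b (Nat.div_pos hZX hZ).ne'
  · rw [mul_comm, ← Nat.div_lt_iff_lt_mul hZ]
    exact Nat.lt_pow_succ_log_self hb _

/-- Palindromes with `N` digits, coprime to the base, with a square divisor from `[D, 2D]`. -/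
lemma card_palindromes_square_dvd_le {b D y N : ℕ} (S : Finset ℕ) (hb : 2 ≤ b)
    (hy : 48 * b ^ 2 ≤ y) (hDlo : y ^ 230 ≤ D) (hDhi : D ≤ y ^ 259)
    (hlog : (∑ l ∈ Finset.Ico 1 (y ^ 42), 1 / (l : ℝ)) * ∑ s ∈ Finset.Ico 1 (y ^ 87), 1 / (s : ℝ)
      ≤ y)
    (hS : ∀ n ∈ S, (Nat.digits b n).Palindrome ∧ (Nat.digits b n).length = N ∧ n.Coprime b ∧
      n ≤ y ^ 1001 ∧ ∃ d, D ≤ d ∧ d ≤ 2 * D ∧ d ^ 2 ∣ n) :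
    S.card ≤ 28 * b ^ 2 * y ^ 492 := by
  classical
  have hbpos : 0 < b := by omega
  have hyb : 48 * b ≤ y := le_trans (by nlinarith) hy
  have hypos : 0 < y := by omega
  have hDpos : 0 < D := lt_of_lt_of_le (by positivity) hDlo
  rcases S.eq_empty_or_nonempty with he | ⟨n₀, hn₀⟩
  · simp [he]
  have hmono : ∀ {e f : ℕ}, e ≤ f → y ^ e ≤ y ^ f := fun h => Nat.pow_le_pow_right hypos h
  have hsmono : ∀ {e f : ℕ}, e < f → y ^ e < y ^ f := fun h => Nat.pow_lt_pow_right (by omega) h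
  have hNpos : 0 < N := by
    rw [← (hS n₀ hn₀).2.1, List.length_pos_iff, Ne, Nat.digits_eq_nil_iff_eq_zero]
    rintro rfl
    have := (hS 0 hn₀).2.2.1
    rw [Nat.coprime_zero_left] at this
    omega
  have hN1 : b ^ (N - 1) ≤ n₀ := by
    have := (Nat.lt_digits_length_iff (b := b) (k := N - 1) (by omega) n₀).1
    rw [(hS n₀ hn₀).2.1] at this
    exact this (Nat.sub_lt hNpos one_pos)
  have hNhi : b ^ N ≤ b * y ^ 1001 := by
    calc b ^ N = b * b ^ (N - 1) := by rw [← pow_succ', Nat.sub_add_cancel hNpos]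
      _ ≤ b * y ^ 1001 := Nat.mul_le_mul_left _ (hN1.trans (hS n₀ hn₀).2.2.2.1)
  rcases lt_or_ge (b ^ (N - 1)) (y ^ 983) with hlt | hge
  · refine (card_palindromes_le S hb fun n hn => ⟨(hS n hn).1, (hS n hn).2.1⟩).trans ?_
    have h1 : b ^ (N - N / 2) ≤ b * y ^ 492 := by
      refine (Nat.pow_le_pow_iff_left two_ne_zero).1 ?_
      calc (b ^ (N - N / 2)) ^ 2 = b ^ (2 * (N - N / 2)) := by rw [← pow_mul, mul_comm]
        _ ≤ b ^ (N - 1 + 2) := Nat.pow_le_pow_right hbpos (by omega)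
        _ = b ^ 2 * b ^ (N - 1) := by ring
        _ ≤ b ^ 2 * y ^ 983 := Nat.mul_le_mul_left _ hlt.le
        _ ≤ b ^ 2 * y ^ 984 := Nat.mul_le_mul_left _ (hmono (by norm_num))
        _ = _ := by ring
    refine h1.trans (Nat.mul_le_mul_right _ ?_)
    nlinarith
  obtain ⟨k, hk1, hk2⟩ : ∃ k, y ^ 510 ≤ D * b ^ k ∧ D * b ^ k ≤ b * y ^ 510 := by
    obtain ⟨k, h1, h2⟩ :=
      exists_mul_pow_le_lt hb hDpos (hDhi.trans (hmono (by norm_num : 259 ≤ 510)))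
    refine ⟨k + 1, h2.le, ?_⟩
    rw [pow_succ', mul_left_comm]
    exact Nat.mul_le_mul_left _ h1
  obtain ⟨j, hj1, hj2⟩ : ∃ j, b ^ j * y ^ 42 ≤ D ∧ D ≤ b ^ (j + 1) * y ^ 42 := by
    obtain ⟨j, h1, h2⟩ := exists_mul_pow_le_lt (b := b) hb (pow_pos hypos 42)
      ((hmono (by norm_num : 42 ≤ 230)).trans hDlo)
    exact ⟨j, by linarith, by linarith⟩
  have hj0 : 1 ≤ j := by
    by_contra hj
    obtain rfl : j = 0 := by omega
    have : y ^ 230 ≤ y ^ 43 := by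
      calc y ^ 230 ≤ D := hDlo
        _ ≤ b ^ (0 + 1) * y ^ 42 := hj2
        _ ≤ y * y ^ 42 := by
          rw [zero_add, pow_one]
          gcongr
          omega
        _ = y ^ 43 := by ring
    exact absurd this (not_le.2 (hsmono (by norm_num)))
  have hjk : j + 1 ≤ k := by
    by_contra hjk
    have : y ^ 552 ≤ y ^ 518 := by
      calc y ^ 552 = y ^ 510 * y ^ 42 := by ring
        _ ≤ D * b ^ k * y ^ 42 := Nat.mul_le_mul_right _ hk1
        _ ≤ D * b ^ j * y ^ 42 := by gcongr; omega
        _ = D * (b ^ j * y ^ 42) := by ring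
        _ ≤ D * D := Nat.mul_le_mul_left _ hj1
        _ ≤ y ^ 259 * y ^ 259 := Nat.mul_le_mul hDhi hDhi
        _ = y ^ 518 := by ring
    exact absurd this (not_le.2 (hsmono (by norm_num)))
  have hkN : k ≤ N := by
    by_contra hkN
    have : y ^ 983 ≤ y ^ 511 := by
      calc y ^ 983 ≤ b ^ (N - 1) := hge
        _ ≤ b ^ k := Nat.pow_le_pow_right hbpos (by omega)
        _ ≤ D * b ^ k := Nat.le_mul_of_pos_left _ hDpos
        _ ≤ b * y ^ 510 := hk2
        _ ≤ y * y ^ 510 := by gcongr; omega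
        _ = y ^ 511 := by ring
    exact absurd this (not_le.2 (hsmono (by norm_num)))
  have hQ : b ^ (k - j - 1) * y ^ 87 ≤ D := by
    refine Nat.le_of_mul_le_mul_right (c := D ^ 2) ?_ (by positivity)
    calc b ^ (k - j - 1) * y ^ 87 * D ^ 2 = b ^ (k - j - 1) * y ^ 87 * D * D := by ring
      _ ≤ b ^ (k - j - 1) * y ^ 87 * D * (b ^ (j + 1) * y ^ 42) := Nat.mul_le_mul_left _ hj2
      _ = D * b ^ (k - j - 1 + (j + 1)) * y ^ 129 := by ring
      _ = D * b ^ k * y ^ 129 := by rw [show k - j - 1 + (j + 1) = k by omega]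
      _ ≤ b * y ^ 510 * y ^ 129 := Nat.mul_le_mul_right _ hk2
      _ ≤ y * y ^ 510 * y ^ 129 := by gcongr; omega
      _ = y ^ 640 := by ring
      _ ≤ y ^ 690 := hmono (by norm_num)
      _ = (y ^ 230) ^ 3 := by ring
      _ ≤ D ^ 3 := Nat.pow_le_pow_left hDlo 3
      _ = D * D ^ 2 := by ring
  have hfib : ∀ u ∈ Finset.range (b ^ k),
      y ^ 18 * (S.filter fun n => n / b ^ (N - k) = u).card ≤ 28 * b * D := by
    intro u hu
    rcases (S.filter fun n => n / b ^ (N - k) = u).eq_empty_or_nonempty with he | ⟨n₁, hn₁⟩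
    · simp [he]
    rw [Finset.mem_filter] at hn₁
    refine card_le_of_dvd_square_of_mod_eq (k := k) (P := b ^ (j - 1)) (Q := b ^ (k - j - 1))
      (U := u * b ^ (N - k)) (H := b ^ (N - k)) (v := n₁ % b ^ k) _ hb (by positivity)
      (by positivity) ?_ ?_ hQ hyb hDlo hDhi ?_ ?_ ?_ hlog ?_
    · rw [← pow_succ', ← pow_succ', ← pow_add]
      congr 1
      omega
    · calc b ^ (j - 1) * y ^ 42 ≤ b ^ j * y ^ 42 := by gcongr; omega
        _ ≤ D := hj1
    · calc y ^ 983 ≤ b ^ (N - 1) := hge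
        _ = b ^ (k - 1) * b ^ (N - k) := by rw [← pow_add]; congr 1; omega
        _ ≤ u * b ^ (N - k) := by
          refine Nat.mul_le_mul_right _ ?_
          rw [← hn₁.2, Nat.le_div_iff_mul_le (by positivity), ← pow_add,
            show k - 1 + (N - k) = N - 1 by omega]
          have := (Nat.lt_digits_length_iff (b := b) (k := N - 1) (by omega) n₁).1
          rw [(hS n₁ hn₁.1).2.1] at this
          exact this (Nat.sub_lt hNpos one_pos)
    · rw [← hn₁.2]
      exact (Nat.div_mul_le_self _ _).trans (hS n₁ hn₁.1).2.2.2.1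
    · refine Nat.le_of_mul_le_mul_right (c := b ^ k) ?_ (by positivity)
      calc 8 * y ^ 18 * b ^ (N - k) * b ^ k = 8 * y ^ 18 * b ^ (N - k + k) := by ring
        _ = 8 * y ^ 18 * b ^ N := by rw [Nat.sub_add_cancel hkN]
        _ ≤ 8 * y ^ 18 * (b * y ^ 1001) := Nat.mul_le_mul_left _ hNhi
        _ = 8 * b * y ^ 1019 := by ring
        _ ≤ y * y ^ 1019 := by gcongr; omega
        _ = (y ^ 510) ^ 2 := by ring
        _ ≤ (D * b ^ k) ^ 2 := Nat.pow_le_pow_left hk1 2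
        _ = _ := by ring
    · intro n hn
      rw [Finset.mem_filter] at hn
      obtain ⟨h1, h2, h3, -, h4⟩ := hS n hn.1
      refine ⟨?_, ?_, ?_, h3, h4⟩
      · rw [← hn.2]
        exact Nat.div_mul_le_self _ _
      · rw [← hn.2]
        exact Nat.lt_div_mul_add (by positivity)
      · exact mod_pow_eq_of_palindrome_of_div_pow_eq hb h1 (hS n₁ hn₁.1).1 h2 (hS n₁ hn₁.1).2.1
          hkN (hn.2.trans hn₁.2.symm)
  have hmaps : ∀ n ∈ S, n / b ^ (N - k) ∈ Finset.range (b ^ k) := by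
    intro n hn
    rw [Finset.mem_range, Nat.div_lt_iff_lt_mul (by positivity), ← pow_add,
      Nat.add_sub_cancel' hkN, ← (hS n hn).2.1]
    exact Nat.lt_base_pow_length_digits hb
  refine le_of_mul_le_mul_left (a := y ^ 18) ?_ (by positivity)
  calc y ^ 18 * S.card = ∑ u ∈ Finset.range (b ^ k),
        y ^ 18 * (S.filter fun n => n / b ^ (N - k) = u).card := by
        rw [Finset.card_eq_sum_card_fiberwise hmaps, Finset.mul_sum]
    _ ≤ ∑ u ∈ Finset.range (b ^ k), 28 * b * D := Finset.sum_le_sum hfib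
    _ = 28 * b * (D * b ^ k) := by
        rw [Finset.sum_const, Finset.card_range, smul_eq_mul]; ring
    _ ≤ 28 * b * (b * y ^ 510) := Nat.mul_le_mul_left _ hk2
    _ = y ^ 18 * (28 * b ^ 2 * y ^ 492) := by ring

lemma card_palindromes_square_dvd_le_pow {b D y : ℕ} (S : Finset ℕ) (hb : 2 ≤ b)
    (hy : 28 * b ^ 2 * (1001 * (Nat.log 2 y + 1) + 1) ≤ y) (hDlo : y ^ 230 ≤ D) (hDhi : D ≤ y ^ 259)
    (hlog : (∑ l ∈ Finset.Ico 1 (y ^ 42), 1 / (l : ℝ)) * ∑ s ∈ Finset.Ico 1 (y ^ 87), 1 / (s : ℝ)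
      ≤ y)
    (hS : ∀ n ∈ S, (Nat.digits b n).Palindrome ∧ n.Coprime b ∧
      n ≤ y ^ 1001 ∧ ∃ d, D ≤ d ∧ d ≤ 2 * D ∧ d ^ 2 ∣ n) :
    S.card ≤ y ^ 493 := by
  classical
  set R := 1001 * (Nat.log 2 y + 1) + 1 with hR
  have hy48 : 48 * b ^ 2 ≤ y := by
    have hR2 : 2 ≤ R := by omega
    have := Nat.mul_le_mul_left (28 * b ^ 2) hR2
    omega
  have hmaps : ∀ n ∈ S, (Nat.digits b n).length ∈ Finset.range R := by
    intro n hn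
    rw [Finset.mem_range, hR, Nat.lt_succ_iff]
    by_contra! h
    rw [Nat.lt_digits_length_iff hb] at h
    have h1 : y < 2 ^ (Nat.log 2 y + 1) := Nat.lt_pow_succ_log_self one_lt_two y
    have h2 : y ^ 1001 < y ^ 1001 := by
      calc y ^ 1001 < (2 ^ (Nat.log 2 y + 1)) ^ 1001 := Nat.pow_lt_pow_left h1 (by norm_num)
        _ = 2 ^ (1001 * (Nat.log 2 y + 1)) := by rw [← pow_mul, mul_comm]
        _ ≤ b ^ (1001 * (Nat.log 2 y + 1)) := Nat.pow_le_pow_left hb _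
        _ ≤ n := h
        _ ≤ y ^ 1001 := (hS n hn).2.2.1
    exact lt_irrefl _ h2
  rw [Finset.card_eq_sum_card_fiberwise hmaps]
  calc _ ≤ ∑ N ∈ Finset.range R, 28 * b ^ 2 * y ^ 492 := by
        refine Finset.sum_le_sum fun N _ =>
          card_palindromes_square_dvd_le (N := N) _ hb hy48 hDlo hDhi hlog fun n hn => ?_
        rw [Finset.mem_filter] at hn
        exact ⟨(hS n hn.1).1, hn.2, (hS n hn.1).2⟩
    _ = 28 * b ^ 2 * R * y ^ 492 := by
        rw [Finset.sum_const, Finset.card_range, smul_eq_mul]; ring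
    _ ≤ y * y ^ 492 := Nat.mul_le_mul_right _ hy
    _ = y ^ 493 := by ring

lemma sum_Ico_one_div_le (n : ℕ) : ∑ l ∈ Finset.Ico 1 n, 1 / (l : ℝ) ≤ 1 + Real.log n := by
  refine le_trans ?_ (harmonic_le_one_add_log n)
  rw [harmonic_eq_sum_Icc]
  push_cast
  simp_rw [one_div]
  exact Finset.sum_le_sum_of_subset_of_nonneg
    (fun l hl => by simp only [Finset.mem_Ico, Finset.mem_Icc] at hl ⊢; omega)
    fun _ _ _ => by positivity

lemma eventually_log_conditions (b : ℕ) (T : ℝ) : ∀ᶠ y : ℕ in Filter.atTop, T ≤ y ∧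
    28 * b ^ 2 * (1001 * (Nat.log 2 y + 1) + 1) ≤ y ∧
    (∑ l ∈ Finset.Ico 1 (y ^ 42), 1 / (l : ℝ)) * ∑ s ∈ Finset.Ico 1 (y ^ 87), 1 / (s : ℝ) ≤ y := by
  set c : ℝ := 200000 * (b ^ 2 + 1) with hc
  have hc0 : 0 < c := by positivity
  have h1 := (Real.isLittleO_pow_log_id_atTop (n := 2)).bound (inv_pos.2 hc0)
  have h2 := tendsto_natCast_atTop_atTop (R := ℝ) |>.eventually h1
  have h3 :=
    (Real.tendsto_log_atTop.comp (tendsto_natCast_atTop_atTop (R := ℝ))).eventually_ge_atTop 1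
  filter_upwards [h2, h3, tendsto_natCast_atTop_atTop.eventually_ge_atTop T] with y h2 h3 h4
  simp only [Function.comp_apply] at h3
  rw [id, Real.norm_of_nonneg (by positivity), Real.norm_of_nonneg (by positivity),
    inv_mul_eq_div, le_div_iff₀ hc0] at h2
  set g := Real.log y with hg
  have hb0 : (0 : ℝ) ≤ (b : ℝ) ^ 2 := by positivity
  have hgg : g ≤ g ^ 2 := by nlinarith
  refine ⟨h4, ?_, ?_⟩
  · have h5 : (Nat.log 2 y : ℝ) ≤ 2 * g := by
      have h6 : (Nat.log 2 y : ℝ) ≤ Real.logb 2 y := by exact_mod_cast Real.natLog_le_logb y 2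
      refine h6.trans ?_
      rw [Real.logb, div_le_iff₀ (Real.log_pos one_lt_two)]
      have := Real.log_two_gt_d9
      nlinarith
    have : (28 * b ^ 2 * (1001 * (Nat.log 2 y + 1) + 1) : ℝ) ≤ y := by
      calc (28 * b ^ 2 * (1001 * (Nat.log 2 y + 1) + 1) : ℝ) ≤
            28 * b ^ 2 * (1001 * (2 * g ^ 2 + g ^ 2) + g ^ 2) := by
            gcongr <;> linarith
        _ = g ^ 2 * (84112 * b ^ 2) := by ring
        _ ≤ g ^ 2 * c := by gcongr; linarith
        _ ≤ y := h2
    exact_mod_cast this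
  · have h5 := sum_Ico_one_div_le (y ^ 42)
    have h6 := sum_Ico_one_div_le (y ^ 87)
    push_cast at h5 h6
    rw [Real.log_pow] at h5 h6
    push_cast at h5 h6
    calc _ ≤ (1 + 42 * g) * (1 + 87 * g) :=
          mul_le_mul h5 h6 (Finset.sum_nonneg fun _ _ => by positivity) (by positivity)
      _ ≤ (43 * g) * (88 * g) := by gcongr <;> linarith
      _ = g ^ 2 * 3784 := by ring
      _ ≤ g ^ 2 * c := by gcongr; linarith
      _ ≤ y := h2

lemma Scount_le_of_forall_finset {b : ℕ} {x D B : ℝ} (hB : 0 ≤ B)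
    (h : ∀ S : Finset ℕ, (∀ n ∈ S, n ∈ PstarSet b x ∧
      ∃ d : ℕ, D ≤ (d : ℝ) ∧ (d : ℝ) ≤ 2 * D ∧ d ^ 2 ∣ n) → (S.card : ℝ) ≤ B) :
    (Scount b x D : ℝ) ≤ B := by
  unfold Scount
  rcases Set.finite_or_infinite {n : ℕ | n ∈ PstarSet b x ∧
      ∃ d : ℕ, D ≤ (d : ℝ) ∧ (d : ℝ) ≤ 2 * D ∧ d ^ 2 ∣ n} with hf | hf
  · rw [Set.ncard_eq_toFinset_card _ hf]
    exact h _ fun n hn => hf.mem_toFinset.1 hn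
  · rw [hf.ncard]
    exact_mod_cast hB

lemma Scount_le_self {b : ℕ} {x D : ℝ} (hx : 0 ≤ x) : (Scount b x D : ℝ) ≤ x := by
  refine Scount_le_of_forall_finset hx fun S hS => ?_
  have hsub : S ⊆ Finset.Ioc 0 ⌊x⌋₊ := fun n hn =>
    Finset.mem_Ioc.2 ⟨(hS n hn).1.1, Nat.le_floor (hS n hn).1.2.1⟩
  have := Finset.card_le_card hsub
  rw [Nat.card_Ioc, Nat.sub_zero] at this
  exact (Nat.cast_le.2 this).trans (Nat.floor_le hx)

lemma Scount_le_pow {b y : ℕ} {x D : ℝ} (hb : 2 ≤ b)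
    (hy : 28 * b ^ 2 * (1001 * (Nat.log 2 y + 1) + 1) ≤ y) (hDlo : (y : ℝ) ^ 230 ≤ D)
    (hDhi : D ≤ (y : ℝ) ^ 259) (hx : x ≤ (y : ℝ) ^ 1001)
    (hlog : (∑ l ∈ Finset.Ico 1 (y ^ 42), 1 / (l : ℝ)) * ∑ s ∈ Finset.Ico 1 (y ^ 87), 1 / (s : ℝ)
      ≤ y) :
    (Scount b x D : ℝ) ≤ (y : ℝ) ^ 493 := by
  refine Scount_le_of_forall_finset (pow_nonneg y.cast_nonneg 493) fun S hS => ?_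
  have h : S.card ≤ y ^ 493 := by
    refine card_palindromes_square_dvd_le_pow (D := ⌈D⌉₊) S hb hy
      (by exact_mod_cast hDlo.trans (Nat.le_ceil D)) (Nat.ceil_le.2 (by exact_mod_cast hDhi)) hlog
      fun n hn => ?_
    obtain ⟨⟨-, h1, h2, h3⟩, d, h4, h5, h6⟩ := hS n hn
    have hcop : n.Coprime b :=
      Nat.Coprime.coprime_dvd_right (Nat.dvd_sub (dvd_pow_self b three_ne_zero) dvd_rfl) h3
    refine ⟨h2.2, hcop, (Nat.cast_le (α := ℝ)).1 (by rw [Nat.cast_pow]; exact h1.trans hx), d,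
      Nat.ceil_le.2 h4, ?_, h6⟩
    have : (d : ℝ) ≤ 2 * (⌈D⌉₊ : ℝ) := h5.trans (by gcongr; exact Nat.le_ceil D)
    exact_mod_cast this
  exact_mod_cast h

lemma Scount_le_rpow {b y : ℕ} {x D w ε : ℝ} (hb : 2 ≤ b) (hε : 0 < ε) (hw1 : 1 ≤ w)
    (hwx : w ^ 1000 = x) (hyw : (y : ℝ) ≤ w) (hwy : w < y + 1)
    (hy1 : ∀ e ≤ 1000, (2 : ℝ) ^ e ≤ y)
    (hy2 : 28 * b ^ 2 * (1001 * (Nat.log 2 y + 1) + 1) ≤ y)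
    (hy3 : (∑ l ∈ Finset.Ico 1 (y ^ 42), 1 / (l : ℝ)) * ∑ s ∈ Finset.Ico 1 (y ^ 87), 1 / (s : ℝ)
      ≤ y)
    (hD1 : x ^ ((3 : ℝ) / 13 + 3 * ε) ≤ D) (hD2 : D ≤ x ^ ((8 : ℝ) / 31 - ε)) :
    (Scount b x D : ℝ) ≤ x ^ ((1 : ℝ) / 2 - ε) := by
  have hx0 : 0 ≤ x := by rw [← hwx]; exact pow_nonneg (by linarith only [hw1]) _
  have hwpow : ∀ r : ℝ, x ^ r = w ^ (1000 * r) := by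
    intro r
    rw [← hwx, ← Real.rpow_natCast, ← Real.rpow_mul (by linarith only [hw1])]
    norm_num
  have h2y : (2 : ℝ) ≤ y := by simpa using hy1 1 (by norm_num)
  have hy0 : (0 : ℝ) < y := by linarith only [h2y]
  have hw2y : w ≤ 2 * y := by linarith only [hwy, h2y]
  have hwlt : 1 < w := by linarith only [hyw, h2y]
  have hxlt : 1 < x := by
    rw [← hwx]
    exact one_lt_pow₀ hwlt (by norm_num)
  have hεsmall : (3 : ℝ) / 13 + 3 * ε ≤ 8 / 31 - ε :=
    (Real.rpow_le_rpow_left_iff hxlt).1 (hD1.trans hD2)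
  have hD0 : 0 ≤ D := le_trans (by positivity) hD1
  have hDlo : (y : ℝ) ^ 230 ≤ D := by
    calc (y : ℝ) ^ 230 ≤ w ^ 230 := by gcongr
      _ = w ^ (230 : ℝ) := by norm_cast
      _ ≤ w ^ (1000 * ((3 : ℝ) / 13 + 3 * ε)) :=
        Real.rpow_le_rpow_of_exponent_le hw1 (by linarith only [hε])
      _ = _ := (hwpow _).symm
      _ ≤ D := hD1
  have hDhi : D ≤ (y : ℝ) ^ 259 := by
    refine (pow_le_pow_iff_left₀ hD0 (by positivity) two_ne_zero).1 ?_
    calc D ^ 2 ≤ (x ^ ((8 : ℝ) / 31 - ε)) ^ 2 := by gcongr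
      _ = w ^ (1000 * ((8 : ℝ) / 31 - ε) * 2) := by
        rw [hwpow, ← Real.rpow_natCast, ← Real.rpow_mul (by linarith only [hw1]), Nat.cast_ofNat]
      _ ≤ w ^ (517 : ℝ) := Real.rpow_le_rpow_of_exponent_le hw1 (by linarith only [hε])
      _ = w ^ 517 := by norm_cast
      _ ≤ (2 * y : ℝ) ^ 517 := by gcongr
      _ = 2 ^ 517 * (y : ℝ) ^ 517 := mul_pow _ _ _
      _ ≤ y * (y : ℝ) ^ 517 := by
        gcongr
        exact hy1 517 (by norm_num)
      _ = ((y : ℝ) ^ 259) ^ 2 := by rw [← pow_succ', ← pow_mul]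
  have hxy : x ≤ (y : ℝ) ^ 1001 := by
    calc x = w ^ 1000 := hwx.symm
      _ ≤ (2 * y : ℝ) ^ 1000 := by gcongr
      _ = 2 ^ 1000 * (y : ℝ) ^ 1000 := mul_pow _ _ _
      _ ≤ y * (y : ℝ) ^ 1000 := by
        gcongr
        exact hy1 1000 le_rfl
      _ = _ := by rw [← pow_succ']
  calc (Scount b x D : ℝ) ≤ (y : ℝ) ^ 493 := Scount_le_pow hb hy2 hDlo hDhi hxy hy3
    _ ≤ w ^ 493 := by gcongr
    _ = w ^ (493 : ℝ) := by norm_cast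
    _ ≤ w ^ (1000 * ((1 : ℝ) / 2 - ε)) :=
      Real.rpow_le_rpow_of_exponent_le hw1 (by linarith only [hε, hεsmall])
    _ = x ^ ((1 : ℝ) / 2 - ε) := (hwpow _).symm

/-- For all `b ≥ 2` and `ε ∈ (0, 0.1)`, if `x^{3/13+3ε} ≤ D ≤ x^{8/31-ε}` then
`S_b(x,D) ≪_{b,ε} x^{1/2-ε}`. -/
theorem Scount_le_AB_process_nontrivial (b : ℕ) (hb : 2 ≤ b) (ε : ℝ)
    (hε : 0 < ε) (hε' : ε < 0.1) :
    ∃ C : ℝ, ∀ x D : ℝ, 1 ≤ x → x ^ ((3 : ℝ) / 13 + 3 * ε) ≤ D → D ≤ x ^ ((8 : ℝ) / 31 - ε) →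
      (Scount b x D : ℝ) ≤ C * x ^ ((1 : ℝ) / 2 - ε) := by
  obtain ⟨Y, hY⟩ := Filter.eventually_atTop.1 (eventually_log_conditions b (2 ^ 1000))
  refine ⟨((Y : ℝ) + 1) ^ 1000, fun x D hx hD1 hD2 => ?_⟩
  have hx0 : 0 ≤ x := by linarith
  have hpow : 1 ≤ x ^ ((1 : ℝ) / 2 - ε) := Real.one_le_rpow hx (by linarith)
  have hC : 1 ≤ ((Y : ℝ) + 1) ^ 1000 := one_le_pow₀ (by linarith [Y.cast_nonneg (α := ℝ)])
  set w : ℝ := x ^ ((1 : ℝ) / 1000) with hw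
  have hw1 : 1 ≤ w := Real.one_le_rpow hx (by norm_num)
  have hwx : w ^ 1000 = x := by
    rw [hw, ← Real.rpow_natCast, ← Real.rpow_mul hx0]
    norm_num
  rcases lt_or_ge ⌊w⌋₊ Y with hlt | hge
  · have h1 : w ≤ (Y : ℝ) + 1 := by
      have := Nat.lt_floor_add_one w
      have : (⌊w⌋₊ : ℝ) ≤ Y := by exact_mod_cast hlt.le
      linarith
    calc (Scount b x D : ℝ) ≤ x := Scount_le_self hx0
      _ = w ^ 1000 := hwx.symm
      _ ≤ ((Y : ℝ) + 1) ^ 1000 := by gcongr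
      _ ≤ _ := le_mul_of_one_le_right (by positivity) hpow
  obtain ⟨hy1, hy2, hy3⟩ := hY _ hge
  refine (Scount_le_rpow hb hε hw1 hwx (Nat.floor_le (zero_le_one.trans hw1)) (Nat.lt_floor_add_one w)
    (fun e he => (pow_le_pow_right₀ one_le_two he).trans hy1) hy2 hy3 hD1 hD2).trans ?_
  exact le_mul_of_one_le_left (by positivity) hC
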